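/- Noncommutative 1ψ1 summation of type I with A central (Theorem on reversed roles): let A and Q commute with all other parameters, ‖Z‖ < 1, ‖B Z^{−1} A^{−1}‖ < 1. Then Σ_{k∈ℤ} ∏_{j=1}^k [(I − B Q^{k−j})^{−1}(I − A Q^{k−j}) Z] = Z^{−1} · ⌊Q, ZBZ^{−1}A^{−1}; A^{−1}Q, Z; Q, I⌉_∞ · ⌈AZ; ZBZ^{−1}; Q, I⌋_∞ · ⌊Z^{−1}A^{−1}Q; BZ^{−1}A^{−1}; Q, I⌉_∞ · Z, where the type I and type II infinite Q-shifted factorials are as defined, with factors multiplied left to right. -/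

import Mathlib

open Filter

/-- Integer powers of `Q`, with negative powers given by powers of `Ring.inverse Q`. -/
noncomputable def zpowR {R : Type*} [Ring R] (Q : R) (m : ℤ) : R :=
  if 0 ≤ m then Q ^ m.toNat else (Ring.inverse Q) ^ (-m).toNat

/-- The bilateral ordered product `∏_{j=1}^k X j`: for `k ≥ 0` it is
`X 1 * X 2 * ⋯ * X k` (left to right), and for `k < 0` it is
`(X 0)⁻¹ * (X (-1))⁻¹ * ⋯ * (X (k+1))⁻¹`, following the inverse-reversed convention. -/
noncomputable def bprod {R : Type*} [Ring R] (X : ℤ → R) (k : ℤ) : R :=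
  if 0 ≤ k then ((List.range k.toNat).map (fun i => X ((i : ℤ) + 1))).prod
  else ((List.range (-k).toNat).map (fun i => Ring.inverse (X (-(i : ℤ))))).prod

/-- The `k`-th term `⌈A; B; Q, Z⌋_k` of the noncommutative bilateral basic hypergeometric
series of type I: `∏_{j=1}^k (I - B Q^{k-j})⁻¹ (I - A Q^{k-j}) Z`. -/
noncomputable def termI {R : Type*} [Ring R] (Q A B Z : R) (k : ℤ) : R :=
  bprod (fun j => Ring.inverse (1 - B * zpowR Q (k - j)) * (1 - A * zpowR Q (k - j)) * Z) k

/-- The `k`-th term `⌊A; B; Q, Z⌉_k` of the noncommutative bilateral basic hypergeometric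
series of type II: `∏_{j=1}^k (I - B Q^{j-1})⁻¹ (I - A Q^{j-1}) Z`. -/
noncomputable def termII {R : Type*} [Ring R] (Q A B Z : R) (k : ℤ) : R :=
  bprod (fun j => Ring.inverse (1 - B * zpowR Q (j - 1)) * (1 - A * zpowR Q (j - 1)) * Z) k

section Identities
variable {k R : Type*} [CommRing k] [Ring R] [Algebra k R]

theorem swap_one_sub_smul (t : k) {D E w : R} (hw : w * (1 - t • D) = 1)
    (hw' : (1 - t • D) * w = 1) :
    (D - E) * (w * (1 - t • E)) = (1 - t • E) * (w * (D - E)) := by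
  have he : D * w = w * D := by
    have : (w * (1 - t • D)) * (D * w) = w * D * ((1 - t • D) * w) := by
      simp only [mul_sub, sub_mul, mul_one, one_mul, smul_mul_assoc, mul_smul_comm, mul_assoc]
    rwa [hw, hw', one_mul, mul_one] at this
  have h1 := congrArg (E * ·) hw
  have h2 := congrArg (· * E) hw'
  simp only [mul_sub, sub_mul, mul_one, one_mul, smul_mul_assoc, mul_smul_comm, mul_assoc]
    at h1 h2 ⊢
  linear_combination (norm := module) h2 - h1 + he

theorem mul_comm_of_inverse_one_sub_smul (c : k) {y w : R} (hw : w * (1 - c • y) = 1)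
    (hw' : (1 - c • y) * w = 1) : y * w = w * y := by
  have : (w * (1 - c • y)) * (y * w) = w * y * ((1 - c • y) * w) := by
    simp only [mul_sub, sub_mul, mul_one, one_mul, smul_mul_assoc, mul_smul_comm, mul_assoc]
  rwa [hw, hw', one_mul, mul_one] at this

theorem intertwine_one_sub_smul (α t : k) {x d w : R}
    (hw : w * (1 - (α * t) • (x * d)) = 1) (hw' : (1 - (α * t) • (x * d)) * w = 1) :
    (1 - α • x) * (w * (x * (1 - t • d))) = x * (1 - t • d) * (w * (1 - α • x)) := by
  have he := mul_comm_of_inverse_one_sub_smul _ hw hw'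
  have h1 := congrArg (x * ·) hw
  have h2 := congrArg (· * x) hw'
  simp only [mul_sub, sub_mul, mul_one, one_mul, smul_mul_assoc, mul_smul_comm, mul_assoc]
    at h1 h2 he ⊢
  linear_combination (norm := module) h2 - h1 + t • he

theorem telescope_one_sub_smul (s α t : k) {x d w : R}
    (hw : w * (1 - (α * t) • (x * d)) = 1) (hw' : (1 - (α * t) • (x * d)) * w = 1) :
    (1 - s • x) - (1 - s • (x * d)) * (t • (w * (1 - α • x)))
      = (1 - t) • (1 : R) - (s - α * t) • (w * (x * (1 - t • d))) := by
  have he := mul_comm_of_inverse_one_sub_smul _ hw hw'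
  have h2 := congrArg (· * x) hw'
  simp only [mul_sub, sub_mul, mul_one, one_mul, smul_mul_assoc, mul_smul_comm, mul_assoc]
    at h2 he hw ⊢
  linear_combination (norm := module) s • h2 - t • hw + (s * t) • he
end Identities

section Central
variable {R : Type*} [Ring R]

theorem inverse_mem_center {a : R} (ha : a ∈ Subring.center R) :
    Ring.inverse a ∈ Subring.center R := by
  by_cases hu : IsUnit a
  · obtain ⟨u, rfl⟩ := hu
    rw [Ring.inverse_unit]
    exact Subring.mem_center_iff.2 fun g =>
      Commute.units_inv_right (show Commute g (u : R) from Subring.mem_center_iff.1 ha g)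
  · rw [Ring.inverse_non_unit _ hu]
    exact zero_mem _

theorem intertwine_of_central {α t x d w : R} (hα : α ∈ Subring.center R)
    (ht : t ∈ Subring.center R) (hw : w * (1 - α * t * (x * d)) = 1)
    (hw' : (1 - α * t * (x * d)) * w = 1) :
    (1 - α * x) * (w * (x * (1 - t * d))) = x * (1 - t * d) * (w * (1 - α * x)) :=
  intertwine_one_sub_smul (⟨α, hα⟩ : Subring.center R) ⟨t, ht⟩ hw hw'

theorem telescope_of_central {s α t x d w : R} (hs : s ∈ Subring.center R)
    (hα : α ∈ Subring.center R) (ht : t ∈ Subring.center R)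
    (hw : w * (1 - α * t * (x * d)) = 1) (hw' : (1 - α * t * (x * d)) * w = 1) :
    (1 - s * x) - (1 - s * (x * d)) * (t * (w * (1 - α * x)))
      = (1 - t) - (s - α * t) * (w * (x * (1 - t * d))) := by
  have := telescope_one_sub_smul (⟨s, hs⟩ : Subring.center R) ⟨α, hα⟩ ⟨t, ht⟩ hw hw'
  simpa [Subring.smul_def] using this

theorem swap_of_central {t D E w : R} (ht : t ∈ Subring.center R) (hw : w * (1 - t * D) = 1)
    (hw' : (1 - t * D) * w = 1) :
    (D - E) * (w * (1 - t * E)) = (1 - t * E) * (w * (D - E)) :=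
  swap_one_sub_smul (⟨t, ht⟩ : Subring.center R) hw hw'

/-- The factor relating consecutive terms of the ₂φ₁ series summed by the noncommutative
`q`-Gauss formula. -/
noncomputable def gaussStep (Q Z D s α t : R) (k : ℕ) : R :=
  (s - α * Q ^ k) * Ring.inverse (1 - t * Q ^ (k + 1)) *
    (Ring.inverse (1 - α * Q ^ k * (Z * D)) * (Z * (1 - t * Q ^ k * D)))

/-- The terms of the noncommutative `q`-Gauss series, normalised to start with `1`. -/
noncomputable def gaussTerm (Q Z D s α t : R) : ℕ → R
  | 0 => 1
  | k + 1 => gaussStep Q Z D s α t k * gaussTerm Q Z D s α t k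

theorem gaussTerm_shift {Q Z D s α : R} (hQ : Q ∈ Subring.center R) (hs : s ∈ Subring.center R)
    (hα : α ∈ Subring.center R) (hu : ∀ k : ℕ, IsUnit (1 - α * Q ^ k * (Z * D)))
    (k : ℕ) :
    gaussTerm Q Z D (s * Q) (α * Q) 1 k * (Ring.inverse (1 - α * (Z * D)) * (1 - α * Z))
      = Q ^ k * (Ring.inverse (1 - α * Q ^ k * (Z * D)) * (1 - α * Z)) *
        gaussTerm Q Z D s α 1 k := by
  induction k with
  | zero => simp [gaussTerm]
  | succ k ih =>
    have hQk : Q ^ k ∈ Subring.center R := pow_mem hQ k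
    have key := intertwine_of_central hα hQk (Ring.inverse_mul_cancel _ (hu k))
      (Ring.mul_inverse_cancel _ (hu k))
    have hσ : (s - α * Q ^ k) * Ring.inverse (1 - 1 * Q ^ (k + 1)) ∈ Subring.center R :=
      mul_mem (sub_mem hs (mul_mem hα hQk))
        (inverse_mem_center (sub_mem (one_mem _) (mul_mem (one_mem _) (pow_mem hQ _))))
    have e1 : gaussStep Q Z D (s * Q) (α * Q) 1 k
        = Q * ((s - α * Q ^ k) * Ring.inverse (1 - 1 * Q ^ (k + 1)) *
          (Ring.inverse (1 - α * Q ^ (k + 1) * (Z * D)) * (Z * (1 - Q ^ k * D)))) := by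
      have e3 : s * Q - α * Q * Q ^ k = Q * (s - α * Q ^ k) := by
        rw [mul_sub, Subring.mem_center_iff.1 hQ, Subring.mem_center_iff.1 hQ, mul_assoc]
      have e4 : α * Q * Q ^ k = α * Q ^ (k + 1) := by rw [pow_succ', mul_assoc]
      rw [gaussStep, e3, e4, one_mul (Q ^ k)]
      simp only [mul_assoc]
    have e2 : gaussStep Q Z D s α 1 k
        = (s - α * Q ^ k) * Ring.inverse (1 - 1 * Q ^ (k + 1)) *
          (Ring.inverse (1 - α * Q ^ k * (Z * D)) * (Z * (1 - Q ^ k * D))) := by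
      rw [gaussStep, one_mul (Q ^ k)]
    rw [gaussTerm, gaussTerm, mul_assoc, ih, e1, e2]
    generalize (s - α * Q ^ k) * Ring.inverse (1 - 1 * Q ^ (k + 1)) = σ at hσ
    generalize Ring.inverse (1 - α * Q ^ k * (Z * D)) = w at key
    generalize Ring.inverse (1 - α * Q ^ (k + 1) * (Z * D)) = w'
    generalize Z * (1 - Q ^ k * D) = P at key
    generalize gaussTerm Q Z D s α 1 k = V
    have hσ' := Subring.mem_center_iff.1 hσ
    have hQk' := Subring.mem_center_iff.1 hQk
    have hQ' := Subring.mem_center_iff.1 hQ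
    calc Q * (σ * (w' * P)) * (Q ^ k * (w * (1 - α * Z)) * V)
        = Q * σ * ((w' * P) * Q ^ k) * ((w * (1 - α * Z)) * V) := by simp only [mul_assoc]
      _ = Q * (σ * Q ^ k) * w' * (P * (w * (1 - α * Z))) * V := by
          rw [hQk']; simp only [mul_assoc]
      _ = (Q * Q ^ k) * ((w' * (1 - α * Z)) * σ) * (w * P) * V := by
          rw [← key, hσ', ← hσ' (Q ^ k)]; simp only [mul_assoc]
      _ = _ := by rw [← pow_succ']; simp only [mul_assoc]

/-- A telescoping relation behind the noncommutative `q`-Gauss sum. -/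
theorem gaussTerm_telescope {Q Z D s α : R} (hQ : Q ∈ Subring.center R)
    (hs : s ∈ Subring.center R) (hα : α ∈ Subring.center R)
    (hu : ∀ k : ℕ, IsUnit (1 - α * Q ^ k * (Z * D)))
    (huQ : ∀ k : ℕ, IsUnit (1 - Q ^ (k + 1))) (k : ℕ) :
    (1 - s * Z) * gaussTerm Q Z D s α 1 k
      - (1 - s * (Z * D)) * (gaussTerm Q Z D (s * Q) (α * Q) 1 k *
        (Ring.inverse (1 - α * (Z * D)) * (1 - α * Z)))
      = (1 - Q ^ k) * gaussTerm Q Z D s α 1 k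
        - (1 - Q ^ (k + 1)) * gaussTerm Q Z D s α 1 (k + 1) := by
  have hQk : Q ^ k ∈ Subring.center R := pow_mem hQ k
  have key := telescope_of_central hs hα hQk (Ring.inverse_mul_cancel _ (hu k))
      (Ring.mul_inverse_cancel _ (hu k))
  have e : (1 - Q ^ (k + 1)) * gaussTerm Q Z D s α 1 (k + 1)
      = (s - α * Q ^ k) * (Ring.inverse (1 - α * Q ^ k * (Z * D)) * (Z * (1 - Q ^ k * D)))
        * gaussTerm Q Z D s α 1 k := by
    have hc : 1 - Q ^ (k + 1) ∈ Subring.center R := sub_mem (one_mem _) (pow_mem hQ _)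
    rw [gaussTerm, gaussStep, one_mul, one_mul, ← mul_assoc, ← mul_assoc, ← mul_assoc,
      ← Subring.mem_center_iff.1 hc, mul_assoc (s - α * Q ^ k), Ring.inverse_mul_cancel _ (huQ k),
      mul_one]
    simp only [mul_assoc]
  rw [gaussTerm_shift hQ hs hα hu, e, ← mul_assoc (1 - s * (Z * D)), ← sub_mul, ← sub_mul, ← key]

/-- Moving `D - E` from left to right through `∏_{i≤n} (1 - Q^i D)⁻¹ (1 - Q^i E)`. -/
theorem swap_prod {Q D E : R} (hQ : Q ∈ Subring.center R)
    (hu : ∀ k : ℕ, IsUnit (1 - Q ^ k * D)) (n : ℕ) :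
    (D - E) * ((List.range (n + 1)).map
        (fun i => Ring.inverse (1 - Q ^ i * D) * (1 - Q ^ i * E))).prod
      = (1 - E) * ((List.range n).map
        (fun i => Ring.inverse (1 - Q ^ i * D) * (1 - Q ^ (i + 1) * E))).prod *
        (Ring.inverse (1 - Q ^ n * D) * (D - E)) := by
  have key (k : ℕ) := swap_of_central (E := E) (pow_mem hQ k) (Ring.inverse_mul_cancel _ (hu k))
    (Ring.mul_inverse_cancel _ (hu k))
  induction n with
  | zero => simpa using key 0
  | succ n ih =>
    rw [List.range_succ, List.map_append, List.prod_append, ← mul_assoc, ih, List.range_succ,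
      List.map_append, List.prod_append]
    simp only [List.map_singleton, List.prod_singleton]
    rw [mul_assoc _ _ (Ring.inverse _ * (1 - Q ^ (n + 1) * E)), mul_assoc (Ring.inverse _),
      key (n + 1)]
    simp only [mul_assoc]

theorem prod_map_range_reflect_succ (g : ℕ → R) (n : ℕ) :
    ((List.range (n + 1)).map (fun i => g (n + 1 - 1 - i))).prod
      = g n * ((List.range n).map (fun i => g (n - 1 - i))).prod := by
  rw [List.range_succ_eq_map, List.map_cons, List.prod_cons, List.map_map]
  congr 3
  funext i
  simp only [Function.comp_apply]
  congr 1
  omega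
end Central

section Bounds
variable {R : Type*} [NormedRing R]

/-- The powers of `Q` together with their limit `0`. -/
def powersWithZero (Q : R) : Set R := insert 0 (Set.range (Q ^ · : ℕ → R))

theorem zero_mem_powersWithZero (Q : R) : (0 : R) ∈ powersWithZero Q := Set.mem_insert _ _

theorem pow_mem_powersWithZero (Q : R) (n : ℕ) : Q ^ n ∈ powersWithZero Q :=
  Set.mem_insert_of_mem _ ⟨n, rfl⟩

theorem one_mem_powersWithZero (Q : R) : (1 : R) ∈ powersWithZero Q := by
  simpa using pow_mem_powersWithZero Q 0

theorem powersWithZero_mem_center {Q t : R} (hQ : Q ∈ Subring.center R)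
    (ht : t ∈ powersWithZero Q) : t ∈ Subring.center R := by
  rcases ht with rfl | ⟨n, rfl⟩
  exacts [zero_mem _, pow_mem hQ n]

theorem isUnit_one_sub_powersWithZero {Q t e : R} (hu : ∀ k : ℕ, IsUnit (1 - Q ^ k * e))
    (ht : t ∈ powersWithZero Q) (k : ℕ) : IsUnit (1 - t * Q ^ k * e) := by
  rcases ht with rfl | ⟨n, rfl⟩
  · simp
  · simpa [pow_add] using hu (n + k)

theorem norm_pow_mul_le (Q y : R) (k : ℕ) : ‖Q ^ k * y‖ ≤ ‖Q‖ ^ k * ‖y‖ := by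
  induction k with
  | zero => simp
  | succ k ih =>
    rw [pow_succ', mul_assoc, pow_succ', mul_assoc]
    exact (norm_mul_le _ _).trans (by gcongr)

theorem norm_powersWithZero_mul_le {Q t : R} (hQ : ‖Q‖ < 1) (ht : t ∈ powersWithZero Q) (k : ℕ)
    (y : R) : ‖t * (Q ^ k * y)‖ ≤ ‖Q‖ ^ k * ‖y‖ := by
  rcases ht with rfl | ⟨n, rfl⟩
  · simp only [zero_mul, norm_zero]; positivity
  · refine (norm_pow_mul_le _ _ _).trans ?_
    calc ‖Q‖ ^ n * ‖Q ^ k * y‖ ≤ 1 * ‖Q ^ k * y‖ := by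
          gcongr; exact pow_le_one₀ (norm_nonneg _) hQ.le
      _ ≤ _ := by rw [one_mul]; exact norm_pow_mul_le _ _ _

theorem tendsto_pow_zero {Q : R} (hQ : ‖Q‖ < 1) :
    Tendsto (fun n : ℕ => Q ^ n) atTop (nhds 0) :=
  tendsto_pow_atTop_nhds_zero_of_norm_lt_one hQ

theorem summable_prod_of_tendsto_lt_one {r : ℕ → ℝ} {ρ : ℝ} (hr : ∀ k, 0 ≤ r k)
    (hlim : Tendsto r atTop (nhds ρ)) (hρ : ρ < 1) (c : ℝ) :
    Summable (fun k => c * ∏ i ∈ Finset.range k, r i) := by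
  obtain ⟨ρ', h1, h2⟩ := exists_between hρ
  refine Summable.mul_left c (summable_of_ratio_norm_eventually_le h2 ?_)
  filter_upwards [hlim.eventually_lt_const h1] with k hk
  rw [Finset.prod_range_succ, norm_mul, mul_comm, Real.norm_of_nonneg (hr k)]
  gcongr

theorem prod_one_add_mul_pow_le {K q : ℝ} (hK : 0 ≤ K) (hq : 0 ≤ q) (hq1 : q < 1) (n : ℕ) :
    ∏ i ∈ Finset.range n, (1 + K * q ^ i) ≤ Real.exp (K * (1 - q)⁻¹) := by
  calc ∏ i ∈ Finset.range n, (1 + K * q ^ i)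
      ≤ ∏ i ∈ Finset.range n, Real.exp (K * q ^ i) :=
        Finset.prod_le_prod (fun i _ => by positivity) fun i _ => by
          rw [add_comm]; exact Real.add_one_le_exp _
    _ = Real.exp (K * ∑ i ∈ Finset.range n, q ^ i) := by rw [← Real.exp_sum, Finset.mul_sum]
    _ ≤ _ := by
        gcongr
        rw [← tsum_geometric_of_lt_one hq hq1]
        exact (summable_geometric_of_lt_one hq hq1).sum_le_tsum _ fun i _ => by positivity

theorem isUnit_gauss_den {Q Z D α γ : R}
    (hα : α ∈ Subring.center R) (hu : ∀ k : ℕ, IsUnit (1 - Q ^ k * (α * (Z * D))))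
    (hγ : γ ∈ powersWithZero Q) (k : ℕ) : IsUnit (1 - α * γ * Q ^ k * (Z * D)) := by
  have e2 : α * γ * Q ^ k * (Z * D) = γ * Q ^ k * (α * (Z * D)) := by
    rw [← mul_assoc (γ * Q ^ k), Subring.mem_center_iff.1 hα, mul_assoc α]
  rw [e2]
  exact isUnit_one_sub_powersWithZero hu hγ k

variable [CompleteSpace R]

theorem Filter.Tendsto.ringInverse {ι : Type*} {l : Filter ι} {f : ι → R} {a : R}
    (hf : Tendsto f l (nhds a)) (ha : IsUnit a) :
    Tendsto (fun i => Ring.inverse (f i)) l (nhds (Ring.inverse a)) := by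
  obtain ⟨u, rfl⟩ := ha
  exact (NormedRing.inverse_continuousAt u).tendsto.comp hf

theorem exists_norm_inverse_one_sub_mul_le {Q e : R} (hQ : ‖Q‖ < 1)
    (hu : ∀ k : ℕ, IsUnit (1 - Q ^ k * e)) :
    ∃ K : ℝ, 0 ≤ K ∧ ∀ t ∈ powersWithZero Q, ∀ (k : ℕ) (y : R),
      ‖Ring.inverse (1 - t * Q ^ k * e) * y‖ ≤ (1 + K * ‖Q‖ ^ k) * ‖y‖ := by
  have hlim : Tendsto (fun k : ℕ => Ring.inverse (1 - Q ^ k * e)) atTop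
      (nhds (Ring.inverse 1)) := by
    refine Tendsto.ringInverse ?_ isUnit_one
    simpa using ((tendsto_pow_zero hQ).mul_const e).const_sub 1
  obtain ⟨M, hM⟩ := hlim.norm.bddAbove_range
  have hM' (k : ℕ) : ‖Ring.inverse (1 - Q ^ k * e)‖ ≤ M := hM ⟨k, rfl⟩
  have hM0 : 0 ≤ M := (norm_nonneg _).trans (hM' 0)
  refine ⟨‖e‖ * M, by positivity, fun t ht k y => ?_⟩
  rcases ht with rfl | ⟨n, rfl⟩
  · simp only [zero_mul, sub_zero, Ring.inverse_one, one_mul]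
    refine le_mul_of_one_le_left (norm_nonneg _) ?_
    have : 0 ≤ ‖e‖ * M * ‖Q‖ ^ k := by positivity
    linarith
  · have hw := Ring.mul_inverse_cancel _ (hu (n + k))
    simp only [← pow_add]
    generalize hw0 : Ring.inverse (1 - Q ^ (n + k) * e) = w at hw
    have hwM : ‖w‖ ≤ M := hw0 ▸ hM' (n + k)
    have : w * y = y + Q ^ n * (Q ^ k * (e * (w * y))) := by
      have h2 := congrArg (· * y) hw
      simp only [sub_mul, one_mul, mul_assoc, pow_add] at h2
      exact sub_eq_iff_eq_add.1 h2
    rw [this]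
    refine (norm_add_le _ _).trans ?_
    have h3 := norm_powersWithZero_mul_le hQ (pow_mem_powersWithZero Q n) k (e * (w * y))
    have h4 : ‖e * (w * y)‖ ≤ ‖e‖ * (M * ‖y‖) :=
      (norm_mul_le _ _).trans (by gcongr; exact (norm_mul_le _ _).trans (by gcongr))
    have h5 : ‖Q‖ ^ k * ‖e * (w * y)‖ ≤ ‖Q‖ ^ k * (‖e‖ * (M * ‖y‖)) := by gcongr
    linarith

theorem exists_norm_gaussTerm_le {Q Z D α : R} (hQ : ‖Q‖ < 1) (hZ : ‖Z‖ < 1)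
    (hQc : Q ∈ Subring.center R) (hα : α ∈ Subring.center R)
    (hu : ∀ k : ℕ, IsUnit (1 - Q ^ k * (α * (Z * D))))
    (huQ : ∀ k : ℕ, IsUnit (1 - Q ^ k * Q)) :
    ∃ b : ℕ → ℝ, Summable b ∧ ∀ s ∈ powersWithZero Q, ∀ γ ∈ powersWithZero Q,
      ∀ t ∈ powersWithZero Q, ∀ k, ‖gaussTerm Q Z D s (α * γ) t k‖ ≤ b k := by
  obtain ⟨K₁, hK₁, h₁⟩ := exists_norm_inverse_one_sub_mul_le hQ huQ
  obtain ⟨K₂, hK₂, h₂⟩ := exists_norm_inverse_one_sub_mul_le hQ hu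
  have hstep : ∀ s ∈ powersWithZero Q, ∀ γ ∈ powersWithZero Q, ∀ t ∈ powersWithZero Q,
      ∀ (k : ℕ) (y : R), ‖gaussStep Q Z D s (α * γ) t k * y‖ ≤
        ((1 + K₁ * ‖Q‖ ^ k) * ((1 + K₂ * ‖Q‖ ^ k) *
          ((‖Z‖ + ‖Q‖ ^ k * (‖α‖ * ‖Z‖)) * (1 + ‖Q‖ ^ k * ‖D‖)))) * ‖y‖ := by
    intro s hs γ hγ t ht k y
    have hsc := powersWithZero_mem_center hQc hs
    have hγc := powersWithZero_mem_center hQc hγ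
    have hσ := Subring.mem_center_iff.1 (sub_mem hsc (mul_mem (mul_mem hα hγc) (pow_mem hQc k)))
    have hα' := Subring.mem_center_iff.1 hα
    have e1 : gaussStep Q Z D s (α * γ) t k * y =
        Ring.inverse (1 - t * Q ^ k * Q) * (Ring.inverse (1 - γ * Q ^ k * (α * (Z * D))) *
          ((s - α * γ * Q ^ k) * (Z * ((1 - t * Q ^ k * D) * y)))) := by
      have e2 : α * γ * Q ^ k * (Z * D) = γ * Q ^ k * (α * (Z * D)) := by
        rw [← mul_assoc (γ * Q ^ k), hα', mul_assoc α]
      rw [gaussStep, e2, pow_succ, ← mul_assoc t, ← hσ]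
      simp only [mul_assoc]
      rw [← mul_assoc (Ring.inverse (1 - γ * (Q ^ k * (α * (Z * D))))) (s - α * (γ * Q ^ k)),
        ← mul_assoc α γ, hσ]
      simp only [mul_assoc]
    have hZy (v : R) : ‖(s - α * γ * Q ^ k) * (Z * v)‖
        ≤ (‖Z‖ + ‖Q‖ ^ k * (‖α‖ * ‖Z‖)) * ‖v‖ := by
      have e3 : (s - α * γ * Q ^ k) * (Z * v) = s * (Z * v)
          - γ * (Q ^ k * (α * (Z * v))) := by
        rw [sub_mul, ← hα' γ, mul_assoc γ, ← hα' (Q ^ k)]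
        simp only [mul_assoc]
      rw [e3]
      refine (norm_sub_le _ _).trans ?_
      have i1 := norm_powersWithZero_mul_le hQ hs 0 (Z * v)
      have i2 := norm_powersWithZero_mul_le hQ hγ k (α * (Z * v))
      have i3 : ‖Z * v‖ ≤ ‖Z‖ * ‖v‖ := norm_mul_le _ _
      have i4 : ‖α * (Z * v)‖ ≤ ‖α‖ * (‖Z‖ * ‖v‖) :=
        (norm_mul_le _ _).trans (by gcongr)
      have i5 : ‖Q‖ ^ k * ‖α * (Z * v)‖ ≤ ‖Q‖ ^ k * (‖α‖ * (‖Z‖ * ‖v‖)) := by gcongr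
      simp only [pow_zero, one_mul] at i1
      linarith
    have hDy : ‖(1 - t * Q ^ k * D) * y‖ ≤ (1 + ‖Q‖ ^ k * ‖D‖) * ‖y‖ := by
      have e4 : (1 - t * Q ^ k * D) * y = y - t * (Q ^ k * (D * y)) := by
        simp only [sub_mul, one_mul, mul_assoc]
      rw [e4]
      refine (norm_sub_le _ _).trans ?_
      have i1 := norm_powersWithZero_mul_le hQ ht k (D * y)
      have i2 : ‖Q‖ ^ k * ‖D * y‖ ≤ ‖Q‖ ^ k * (‖D‖ * ‖y‖) := by
        gcongr; exact norm_mul_le _ _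
      linarith
    rw [e1, mul_assoc (1 + K₁ * _), mul_assoc (1 + K₂ * _), mul_assoc (‖Z‖ + _)]
    exact (h₁ t ht k _).trans (mul_le_mul_of_nonneg_left ((h₂ γ hγ k _).trans
      (mul_le_mul_of_nonneg_left ((hZy _).trans (mul_le_mul_of_nonneg_left hDy
        (by positivity))) (by positivity))) (by positivity))
  have hq : Tendsto (fun k : ℕ => ‖Q‖ ^ k) atTop (nhds 0) :=
    tendsto_pow_atTop_nhds_zero_of_lt_one (norm_nonneg _) hQ
  have hlim : Tendsto (fun k : ℕ => (1 + K₁ * ‖Q‖ ^ k) * ((1 + K₂ * ‖Q‖ ^ k) *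
          ((‖Z‖ + ‖Q‖ ^ k * (‖α‖ * ‖Z‖)) * (1 + ‖Q‖ ^ k * ‖D‖)))) atTop (nhds ‖Z‖) := by
    have := ((hq.const_mul K₁).const_add 1).mul (((hq.const_mul K₂).const_add 1).mul
      (((hq.mul_const (‖α‖ * ‖Z‖)).const_add ‖Z‖).mul ((hq.mul_const ‖D‖).const_add 1)))
    simpa using this
  refine ⟨_, summable_prod_of_tendsto_lt_one (fun k => by positivity) hlim hZ ‖(1 : R)‖,
    fun s hs γ hγ t ht k => ?_⟩
  induction k with
  | zero => simp [gaussTerm]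
  | succ k ih =>
    rw [gaussTerm, Finset.prod_range_succ, ← mul_assoc, mul_comm _ (_ * _ : ℝ)]
    refine (hstep s hs γ hγ t ht k _).trans ?_
    gcongr

theorem tendsto_gaussTerm {Q Z D α : R} {s γ t : ℕ → R} {s' γ' t' : R}
    (hs : Tendsto s atTop (nhds s')) (hγ : Tendsto γ atTop (nhds γ'))
    (ht : Tendsto t atTop (nhds t'))
    (hu : ∀ k : ℕ, IsUnit (1 - α * γ' * Q ^ k * (Z * D)))
    (huQ : ∀ k : ℕ, IsUnit (1 - t' * Q ^ (k + 1))) (k : ℕ) :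
    Tendsto (fun n => gaussTerm Q Z D (s n) (α * γ n) (t n) k) atTop
      (nhds (gaussTerm Q Z D s' (α * γ') t' k)) := by
  induction k with
  | zero => exact tendsto_const_nhds
  | succ k ih =>
    refine Tendsto.mul ?_ ih
    have hα := (hγ.const_mul α).mul_const (Q ^ k)
    exact ((hs.sub hα).mul (((ht.mul_const _).const_sub 1).ringInverse (huQ k))).mul
      ((((hα.mul_const (Z * D)).const_sub 1).ringInverse (hu k)).mul
        ((((ht.mul_const _).mul_const D).const_sub 1).const_mul Z))

/-- The sum of the noncommutative `q`-Gauss series. -/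
noncomputable def qGaussSum (Q Z D s α t : R) : R := ∑' k, gaussTerm Q Z D s α t k

theorem tendsto_qGaussSum {Q Z D α : R} (hQ : ‖Q‖ < 1) (hZ : ‖Z‖ < 1)
    (hQc : Q ∈ Subring.center R) (hα : α ∈ Subring.center R)
    (hu : ∀ k : ℕ, IsUnit (1 - Q ^ k * (α * (Z * D))))
    (huQ : ∀ k : ℕ, IsUnit (1 - Q ^ k * Q)) {s γ t : ℕ → R} {s' γ' t' : R}
    (hs : Tendsto s atTop (nhds s')) (hγ : Tendsto γ atTop (nhds γ'))
    (ht : Tendsto t atTop (nhds t'))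
    (hsm : ∀ n, s n ∈ powersWithZero Q) (hγm : ∀ n, γ n ∈ powersWithZero Q)
    (htm : ∀ n, t n ∈ powersWithZero Q)
    (hγ'm : γ' ∈ powersWithZero Q) (ht'm : t' ∈ powersWithZero Q) :
    Tendsto (fun n => qGaussSum Q Z D (s n) (α * γ n) (t n)) atTop
      (nhds (qGaussSum Q Z D s' (α * γ') t')) := by
  obtain ⟨b, hb, hle⟩ := exists_norm_gaussTerm_le hQ hZ hQc hα hu huQ
  refine tendsto_tsum_of_dominated_convergence hb
    (tendsto_gaussTerm hs hγ ht (isUnit_gauss_den hα hu hγ'm) fun k => ?_)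
    (Eventually.of_forall fun n k => hle _ (hsm n) _ (hγm n) _ (htm n) k)
  have := isUnit_one_sub_powersWithZero huQ ht'm k
  rwa [mul_assoc, ← pow_succ] at this

theorem qGaussSum_step {Q Z D s α : R} (hQ : ‖Q‖ < 1) (hZ : ‖Z‖ < 1)
    (hQc : Q ∈ Subring.center R) (hα : α ∈ Subring.center R)
    (hu : ∀ k : ℕ, IsUnit (1 - Q ^ k * (α * (Z * D))))
    (huQ : ∀ k : ℕ, IsUnit (1 - Q ^ k * Q)) (hs : s ∈ powersWithZero Q)
    (hsZ : IsUnit (1 - s * Z)) :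
    qGaussSum Q Z D s α 1 = Ring.inverse (1 - s * Z) * (1 - s * (Z * D)) *
      qGaussSum Q Z D (s * Q) (α * Q) 1 * (Ring.inverse (1 - α * (Z * D)) * (1 - α * Z)) := by
  obtain ⟨b, hb, hle⟩ := exists_norm_gaussTerm_le hQ hZ hQc hα hu huQ
  have hQ1 : Q ∈ powersWithZero Q := by simpa using pow_mem_powersWithZero Q 1
  have hsQ : s * Q ∈ powersWithZero Q := by
    rcases hs with rfl | ⟨n, rfl⟩
    · simpa using zero_mem_powersWithZero Q
    · simpa [pow_succ] using pow_mem_powersWithZero Q (n + 1)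
  have h1 := one_mem_powersWithZero Q
  have hV : Summable (gaussTerm Q Z D s α 1) :=
    Summable.of_norm_bounded hb fun k => by simpa using hle s hs 1 h1 1 h1 k
  have hV' : Summable (gaussTerm Q Z D (s * Q) (α * Q) 1) :=
    Summable.of_norm_bounded hb fun k => hle _ hsQ _ hQ1 1 h1 k
  have huα (k : ℕ) : IsUnit (1 - α * Q ^ k * (Z * D)) := by
    simpa using isUnit_gauss_den hα hu h1 k
  have huQ' (k : ℕ) : IsUnit (1 - Q ^ (k + 1)) := by simpa [pow_succ] using huQ k
  have htel := gaussTerm_telescope hQc (powersWithZero_mem_center hQc hs) hα huα huQ'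
  have hsum := (hV.hasSum.mul_left (1 - s * Z)).sub ((hV'.hasSum.mul_right
    (Ring.inverse (1 - α * (Z * D)) * (1 - α * Z))).mul_left (1 - s * (Z * D)))
  simp only [htel] at hsum
  have hzero := hsum.tendsto_sum_nat
  simp only [Finset.sum_range_sub', pow_zero, sub_self, zero_mul, zero_sub] at hzero
  have hlim : Tendsto (fun n : ℕ => -((1 - Q ^ n) * gaussTerm Q Z D s α 1 n)) atTop (nhds 0) := by
    simpa using (((tendsto_pow_zero hQ).const_sub 1).mul hV.tendsto_atTop_zero).neg
  have := sub_eq_zero.1 (tendsto_nhds_unique hzero hlim)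
  rw [qGaussSum, qGaussSum, mul_assoc, mul_assoc, eq_comm, Ring.inverse_mul_eq_iff_eq_mul _ _ _ hsZ,
    ← this]

end Bounds

theorem qGaussSum_zero_zero {R : Type*} [NormedRing R] (Q Z D t : R) :
    qGaussSum Q Z D 0 0 t = 1 := by
  rw [qGaussSum, tsum_eq_single 0]
  · rfl
  · intro k hk
    obtain ⟨k, rfl⟩ := Nat.exists_eq_succ_of_ne_zero hk
    simp [gaussTerm, gaussStep]

section Gauss
variable {R : Type*} [NormedRing R] [CompleteSpace R]

theorem qGaussSum_iterate {Q Z D s α : R} (hQ : ‖Q‖ < 1) (hZ : ‖Z‖ < 1)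
    (hQc : Q ∈ Subring.center R) (hα : α ∈ Subring.center R)
    (hu : ∀ k : ℕ, IsUnit (1 - Q ^ k * (α * (Z * D))))
    (huQ : ∀ k : ℕ, IsUnit (1 - Q ^ k * Q)) (hs : s ∈ powersWithZero Q)
    (hsZ : ∀ k : ℕ, IsUnit (1 - s * Q ^ k * Z)) (n : ℕ) :
    qGaussSum Q Z D s α 1 =
      ((List.range n).map
        (fun j => Ring.inverse (1 - s * Q ^ j * Z) * (1 - s * Q ^ j * (Z * D)))).prod *
      qGaussSum Q Z D (s * Q ^ n) (α * Q ^ n) 1 *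
      ((List.range n).map (fun i => Ring.inverse (1 - α * Q ^ (n - 1 - i) * (Z * D)) *
        (1 - α * Q ^ (n - 1 - i) * Z))).prod := by
  induction n with
  | zero => simp
  | succ n ih =>
    have hsn : s * Q ^ n ∈ powersWithZero Q := by
      rcases hs with rfl | ⟨m, rfl⟩
      · simpa using zero_mem_powersWithZero Q
      · simpa [pow_add] using pow_mem_powersWithZero Q (m + n)
    have hun (k : ℕ) : IsUnit (1 - Q ^ k * (α * Q ^ n * (Z * D))) := by
      have := hu (k + n)
      rwa [pow_add, mul_assoc, ← mul_assoc (Q ^ n),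
        ← Subring.mem_center_iff.1 (pow_mem hQc n) α] at this
    rw [ih, qGaussSum_step hQ hZ hQc (mul_mem hα (pow_mem hQc n)) hun huQ hsn (hsZ n),
      prod_map_range_reflect_succ
        (fun j => Ring.inverse (1 - α * Q ^ j * (Z * D)) * (1 - α * Q ^ j * Z)),
      List.range_succ, List.map_append, List.prod_append]
    simp only [List.map_singleton, List.prod_singleton, pow_succ, mul_assoc]

theorem tendsto_prod_qGaussSum_zero {Q Z D α : R} (hQ : ‖Q‖ < 1) (hZ : ‖Z‖ < 1)
    (hQc : Q ∈ Subring.center R) (hα : α ∈ Subring.center R)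
    (hu : ∀ k : ℕ, IsUnit (1 - Q ^ k * (α * (Z * D))))
    (huQ : ∀ k : ℕ, IsUnit (1 - Q ^ k * Q)) {P : R}
    (hP : Tendsto (fun n : ℕ => ((List.range n).map
      (fun i => Ring.inverse (1 - α * Q ^ (n - 1 - i) * (Z * D)) *
        (1 - α * Q ^ (n - 1 - i) * Z))).prod) atTop (nhds P)) :
    qGaussSum Q Z D 0 α 1 = P := by
  have h := (tendsto_qGaussSum hQ hZ hQc hα hu huQ (tendsto_const_nhds (x := (0 : R)))
    (tendsto_pow_zero hQ) (tendsto_const_nhds (x := (1 : R)))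
    (fun _ => zero_mem_powersWithZero Q) (pow_mem_powersWithZero Q)
    (fun _ => one_mem_powersWithZero Q) (zero_mem_powersWithZero Q)
    (one_mem_powersWithZero Q)).mul hP
  rw [mul_zero, qGaussSum_zero_zero, one_mul] at h
  refine tendsto_nhds_unique (tendsto_const_nhds.congr fun n => ?_) h
  have := qGaussSum_iterate hQ hZ hQc hα hu huQ (zero_mem_powersWithZero Q) (by simp) n
  rw [this]
  simp

end Gauss

section Negative
variable {R : Type*} [Ring R]

/-- The factor relating consecutive terms of the part of the bilateral series with negative
index, deformed by two central parameters, both `0` in the undeformed series. -/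
noncomputable def negStep (Q A' D E p p' : R) (m : ℕ) : R :=
  (1 - p') * Ring.inverse (1 - A' * Q ^ (m + 1)) *
    (Ring.inverse (1 - p * D) * (D - Q ^ (m + 1) * E))

/-- The terms of negative index, normalised to start with `1`. -/
noncomputable def negTerm (Q A' D E : R) (p p' : ℕ → R) : ℕ → R
  | 0 => 1
  | m + 1 => negStep Q A' D E (p m) (p' m) m * negTerm Q A' D E p p' m

/-- The terms of negative index, deformed so as to vanish from index `N + 1` on. -/
noncomputable def negTermTrunc (Q A' D E : R) (N : ℕ) : ℕ → R :=
  negTerm Q A' D E (fun m => Q ^ (N - 1 - m)) (fun m => Q ^ (N - m))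

theorem negTermTrunc_succ (Q A' D E : R) (N m : ℕ) : negTermTrunc Q A' D E N (m + 1) =
    negStep Q A' D E (Q ^ (N - 1 - m)) (Q ^ (N - m)) m * negTermTrunc Q A' D E N m := rfl

theorem negTermTrunc_eq_zero (Q A' D E : R) {N m : ℕ} (h : N < m) :
    negTermTrunc Q A' D E N m = 0 := by
  induction m with
  | zero => omega
  | succ m ih =>
    rw [negTermTrunc_succ, negStep, Nat.sub_eq_zero_of_le (Nat.le_of_lt_succ h)]
    simp

variable {Q V A A' Z D E : R}

theorem pow_mul_pow_of_mul_eq_one (hQ : Q ∈ Subring.center R) (hV : V * Q = 1) (n : ℕ) :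
    V ^ n * Q ^ n = 1 := by
  rw [← Commute.mul_pow (Subring.mem_center_iff.1 hQ V), hV, one_pow]

theorem gaussStep_mul_negStep (hQ : Q ∈ Subring.center R) (hVc : V ∈ Subring.center R)
    (hA : A ∈ Subring.center R) (hV : V * Q = 1) (hA' : A * A' = 1)
    (hA'c : A' ∈ Subring.center R)
    (hZE : Z * E = A') (huQ : ∀ k : ℕ, IsUnit (1 - Q ^ (k + 1)))
    (huD : ∀ k : ℕ, IsUnit (1 - Q ^ k * D)) (huC : ∀ k : ℕ, IsUnit (1 - A * V ^ k * (Z * D)))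
    (huA : ∀ k : ℕ, IsUnit (1 - A' * Q ^ (k + 1))) (k m : ℕ) :
    gaussStep Q Z D 1 (A * V ^ (k + m + 1)) 1 k *
      negStep Q A' D E (Q ^ k) (Q ^ (k + 1)) m = 1 := by
  have hVQ : A * V ^ (k + m + 1) * Q ^ k = A * V ^ (m + 1) := by
    rw [mul_assoc, show k + m + 1 = m + 1 + k by ring, pow_add, mul_assoc,
      pow_mul_pow_of_mul_eq_one hQ hV, mul_one]
  have hcomm {a : R} (ha : a ∈ Subring.center R) (x : R) : x * a = a * x :=
    Subring.mem_center_iff.1 ha x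
  rw [gaussStep, negStep, hVQ, one_mul, one_mul]
  have ha : A * V ^ (m + 1) ∈ Subring.center R := mul_mem hA (pow_mem hVc _)
  have hq : Q ^ (k + 1) ∈ Subring.center R := pow_mem hQ _
  have hq' : Q ^ (m + 1) ∈ Subring.center R := pow_mem hQ _
  have haq : A * V ^ (m + 1) * (A' * Q ^ (m + 1)) = 1 := by
    rw [mul_assoc, ← mul_assoc (V ^ _), ← hcomm (pow_mem hVc _), mul_assoc,
      pow_mul_pow_of_mul_eq_one hQ hV, mul_one, hA']
  have h1 := Ring.inverse_mul_cancel _ (huQ k)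
  have h2 := Ring.inverse_mul_cancel _ (huC (m + 1))
  have h3 := Ring.mul_inverse_cancel _ (huA m)
  have h4 := Ring.mul_inverse_cancel _ (huD k)
  have hi1 : Ring.inverse (1 - Q ^ (k + 1)) ∈ Subring.center R :=
    inverse_mem_center (sub_mem (one_mem _) hq)
  have hi3 : Ring.inverse (1 - A' * Q ^ (m + 1)) ∈ Subring.center R :=
    inverse_mem_center (sub_mem (one_mem _) (mul_mem hA'c hq'))
  generalize A * V ^ (m + 1) = a at *
  generalize Ring.inverse (1 - Q ^ (k + 1)) = i₁ at *
  generalize Ring.inverse (1 - A' * Q ^ (m + 1)) = i₃ at *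
  generalize Ring.inverse (1 - a * (Z * D)) = w at *
  generalize Ring.inverse (1 - Q ^ k * D) = w' at *
  have hb : a * (A' * Q ^ (m + 1)) = 1 := haq
  have h5 : (1 - a) * i₃ = -a := by
    have : 1 - a = -a * (1 - A' * Q ^ (m + 1)) := by rw [mul_sub, neg_mul, neg_mul, hb]; noncomm_ring
    rw [this, mul_assoc, h3, mul_one]
  have h6 : -a * (Z * (D - Q ^ (m + 1) * E)) = 1 - a * (Z * D) := by
    rw [mul_sub, ← mul_assoc Z, hcomm hq', mul_assoc, hZE, hcomm hA'c, mul_sub, neg_mul, neg_mul,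
      hb]
    noncomm_ring
  calc (1 - a) * i₁ * (w * (Z * (1 - Q ^ k * D))) *
        ((1 - Q ^ (k + 1)) * i₃ * (w' * (D - Q ^ (m + 1) * E)))
      = (1 - a) * (i₁ * ((w * (Z * (1 - Q ^ k * D))) * (1 - Q ^ (k + 1)))) * i₃ *
          (w' * (D - Q ^ (m + 1) * E)) := by simp only [mul_assoc]
    _ = (1 - a) * (i₁ * (1 - Q ^ (k + 1))) * ((w * (Z * (1 - Q ^ k * D))) * i₃) *
          (w' * (D - Q ^ (m + 1) * E)) := by
        rw [hcomm (sub_mem (one_mem _) hq)]; simp only [mul_assoc]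
    _ = ((1 - a) * i₃) * (w * (Z * ((1 - Q ^ k * D) * w') * (D - Q ^ (m + 1) * E))) := by
        rw [h1, hcomm hi3]; simp only [mul_assoc, mul_one]
    _ = w * (-a * (Z * (D - Q ^ (m + 1) * E))) := by
        rw [h5, h4, mul_one, ← mul_assoc w (-a), hcomm (neg_mem ha)]; simp only [mul_assoc]
    _ = 1 := by rw [h6, h2]

theorem gaussTerm_mul_negTermTrunc (hQ : Q ∈ Subring.center R) (hVc : V ∈ Subring.center R)
    (hA : A ∈ Subring.center R) (hV : V * Q = 1) (hA' : A * A' = 1)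
    (hA'c : A' ∈ Subring.center R)
    (hZE : Z * E = A') (huQ : ∀ k : ℕ, IsUnit (1 - Q ^ (k + 1)))
    (huD : ∀ k : ℕ, IsUnit (1 - Q ^ k * D)) (huC : ∀ k : ℕ, IsUnit (1 - A * V ^ k * (Z * D)))
    (huA : ∀ k : ℕ, IsUnit (1 - A' * Q ^ (k + 1))) {N k : ℕ} (hk : k ≤ N) :
    gaussTerm Q Z D 1 (A * V ^ N) 1 k * negTermTrunc Q A' D E N N
      = negTermTrunc Q A' D E N (N - k) := by
  induction k with
  | zero => simp [gaussTerm]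
  | succ k ih =>
    obtain ⟨m, rfl⟩ := Nat.exists_eq_add_of_lt hk
    rw [gaussTerm, mul_assoc, ih (by omega), show k + m + 1 - k = m + 1 by omega,
      negTermTrunc_succ, show k + m + 1 - 1 - m = k by omega, show k + m + 1 - m = k + 1 by omega,
      ← mul_assoc, gaussStep_mul_negStep hQ hVc hA hV hA' hA'c hZE huQ huD huC huA, one_mul,
      show k + m + 1 - (k + 1) = m by omega]

theorem gaussTerm_add_mul_negTermTrunc (hQ : Q ∈ Subring.center R) (hVc : V ∈ Subring.center R)
    (hA : A ∈ Subring.center R) (hV : V * Q = 1) (hA' : A * A' = 1)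
    (hA'c : A' ∈ Subring.center R)
    (hZE : Z * E = A') (huQ : ∀ k : ℕ, IsUnit (1 - Q ^ (k + 1)))
    (huD : ∀ k : ℕ, IsUnit (1 - Q ^ k * D)) (huC : ∀ k : ℕ, IsUnit (1 - A * V ^ k * (Z * D)))
    (huA : ∀ k : ℕ, IsUnit (1 - A' * Q ^ (k + 1))) (N k : ℕ) :
    gaussTerm Q Z D 1 (A * V ^ N) 1 (k + N) * negTermTrunc Q A' D E N N
      = gaussTerm Q Z D 1 A (Q ^ N) k := by
  induction k with
  | zero =>
    rw [zero_add, gaussTerm_mul_negTermTrunc hQ hVc hA hV hA' hA'c hZE huQ huD huC huA le_rfl,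
      Nat.sub_self]
    rfl
  | succ k ih =>
    rw [add_right_comm, gaussTerm, mul_assoc, ih, gaussTerm]
    congr 1
    have hVQ : A * V ^ N * Q ^ (k + N) = A * Q ^ k := by
      rw [add_comm, pow_add, mul_assoc, ← mul_assoc (V ^ N), pow_mul_pow_of_mul_eq_one hQ hV,
        one_mul]
    rw [gaussStep, gaussStep, hVQ, one_mul, one_mul, ← pow_add, ← pow_add, add_comm k N,
      add_assoc N k 1]

/-- The partial products of the type II factorial `⌊E; D; Q, I⌉`. -/
noncomputable def swapProd (Q D E : R) (n : ℕ) : R :=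
  ((List.range n).map (fun i => Ring.inverse (1 - Q ^ i * D) * (1 - Q ^ i * E))).prod

theorem mul_swapProd (hQ : Q ∈ Subring.center R) (hVc : V ∈ Subring.center R)
    (hA : A ∈ Subring.center R) (hV : V * Q = 1) (hA' : A * A' = 1) (hZE : Z * E = A')
    (huD : ∀ k : ℕ, IsUnit (1 - Q ^ k * D)) (huC : ∀ k : ℕ, IsUnit (1 - A * V ^ k * (Z * D)))
    (j n : ℕ) :
    Ring.inverse (1 - A * V ^ j * (Z * D)) * (1 - A * V ^ j * Z) *
        (swapProd Q D (Q ^ (j + 1) * E) n *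
      (Ring.inverse (1 - Q ^ n * D) * (D - Q ^ j * E))) = swapProd Q D (Q ^ j * E) (n + 1) := by
  have hcomm {a : R} (ha : a ∈ Subring.center R) (x : R) : x * a = a * x :=
    Subring.mem_center_iff.1 ha x
  have h := swap_prod (E := Q ^ j * E) hQ huD n
  have e1 : (fun i => Ring.inverse (1 - Q ^ i * D) * (1 - Q ^ (i + 1) * (Q ^ j * E)))
      = fun i => Ring.inverse (1 - Q ^ i * D) * (1 - Q ^ i * (Q ^ (j + 1) * E)) := by
    funext i
    rw [pow_succ', pow_succ', ← hcomm hQ (Q ^ i)]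
    simp only [mul_assoc]
  rw [e1] at h
  change _ * swapProd Q D (Q ^ j * E) (n + 1) = _ * swapProd Q D (Q ^ (j + 1) * E) n * _ at h
  have ha : A * V ^ j ∈ Subring.center R := mul_mem hA (pow_mem hVc _)
  have haq : A * V ^ j * Q ^ j * A' = 1 := by
    rw [mul_assoc A, pow_mul_pow_of_mul_eq_one hQ hV, mul_one, hA']
  have e2 (x : R) : 1 - A * V ^ j * (Z * x) = -(A * V ^ j) * Z * (x - Q ^ j * E) := by
    rw [mul_sub, ← mul_assoc _ (Q ^ j), hcomm (pow_mem hQ j), mul_assoc (Q ^ j),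
      mul_assoc (-(A * V ^ j)) Z E, hZE, ← mul_assoc (Q ^ j), ← hcomm (pow_mem hQ j), neg_mul,
      neg_mul, neg_mul, neg_mul, haq]
    noncomm_ring
  have e3 := e2 1
  rw [mul_one] at e3
  rw [mul_assoc, Ring.inverse_mul_eq_iff_eq_mul _ _ _ (huC j), e2 D, e3, mul_assoc _ (D - _), h]
  simp only [mul_assoc]

theorem prod_mul_negTermTrunc (hQ : Q ∈ Subring.center R) (hVc : V ∈ Subring.center R)
    (hA : A ∈ Subring.center R) (hV : V * Q = 1) (hA' : A * A' = 1)
    (hA'c : A' ∈ Subring.center R) (hZE : Z * E = A')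
    (huD : ∀ k : ℕ, IsUnit (1 - Q ^ k * D)) (huC : ∀ k : ℕ, IsUnit (1 - A * V ^ k * (Z * D)))
    {N m : ℕ} (hm : m ≤ N) :
    ((List.range m).map (fun i => Ring.inverse (1 - A * V ^ (i + 1) * (Z * D)) *
        (1 - A * V ^ (i + 1) * Z))).prod *
      (swapProd Q D (Q ^ (m + 1) * E) (N - m) * negTermTrunc Q A' D E N m)
      = ((List.range m).map (fun j =>
          (1 - Q ^ (N - j)) * Ring.inverse (1 - A' * Q ^ (j + 1)))).prod *
        swapProd Q D (Q * E) N := by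
  have hcomm {a : R} (ha : a ∈ Subring.center R) (x : R) : x * a = a * x :=
    Subring.mem_center_iff.1 ha x
  induction m with
  | zero => simp [negTermTrunc, negTerm]
  | succ m ih =>
    obtain ⟨n, rfl⟩ := Nat.exists_eq_add_of_lt hm
    have ih := ih (by omega)
    rw [show m + n + 1 - m = n + 1 by omega, ← mul_swapProd hQ hVc hA hV hA' hZE huD huC] at ih
    have hc : (1 - Q ^ (n + 1)) * Ring.inverse (1 - A' * Q ^ (m + 1)) ∈ Subring.center R :=
      mul_mem (sub_mem (one_mem _) (pow_mem hQ _))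
        (inverse_mem_center (sub_mem (one_mem _) (mul_mem hA'c (pow_mem hQ _))))
    rw [negTermTrunc_succ, negStep, show m + n + 1 - (m + 1) = n by omega,
      show m + n + 1 - 1 - m = n by omega, show m + n + 1 - m = n + 1 by omega, List.range_succ,
      List.map_append, List.prod_append, List.map_append, List.prod_append]
    simp only [List.map_singleton, List.prod_singleton]
    rw [show m + n + 1 - m = n + 1 by omega, hcomm hc, mul_assoc _ _ (swapProd _ _ _ _), ← ih,
      mul_assoc (_ * Ring.inverse (1 - A' * Q ^ (m + 1))), ← mul_assoc (swapProd _ _ _ _), hcomm hc]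
    simp only [← mul_assoc, hcomm hc]

end Negative

section NegativeBounds
variable {R : Type*} [NormedRing R] [CompleteSpace R] {Q A' D E : R}

theorem exists_norm_negTermTrunc_le (hQ : ‖Q‖ < 1) (hD : ‖D‖ < 1) (hQc : Q ∈ Subring.center R)
    (huD : ∀ k : ℕ, IsUnit (1 - Q ^ k * D)) (huA : ∀ k : ℕ, IsUnit (1 - A' * Q ^ (k + 1))) :
    ∃ b : ℕ → ℝ, Summable b ∧ ∀ N m, ‖negTermTrunc Q A' D E N m‖ ≤ b m := by
  have eA (k : ℕ) : A' * Q ^ (k + 1) = Q ^ k * (Q * A') := by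
    rw [Subring.mem_center_iff.1 (pow_mem hQc (k + 1)), pow_succ, mul_assoc]
  obtain ⟨K₁, hK₁, h₁⟩ := exists_norm_inverse_one_sub_mul_le hQ
    (e := Q * A') (fun k => by rw [← eA]; exact huA k)
  obtain ⟨K₂, hK₂, h₂⟩ := exists_norm_inverse_one_sub_mul_le hQ huD
  have hq := norm_nonneg Q
  set σ : ℕ → ℝ := fun i => (1 + 1 * ‖Q‖ ^ i) * (1 + K₂ * ‖Q‖ ^ i) with hσ
  set r : ℕ → ℝ := fun m => (1 + K₁ * ‖Q‖ ^ m) * (‖D‖ + ‖Q‖ ^ (m + 1) * ‖E‖) with hr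
  have hσ0 (i : ℕ) : 0 ≤ σ i := by positivity
  have hr0 (i : ℕ) : 0 ≤ r i := by positivity
  have hstep (i m : ℕ) (y : R) :
      ‖negStep Q A' D E (Q ^ i) (Q ^ (i + 1)) m * y‖ ≤ σ i * r m * ‖y‖ := by
    have i1 (v : R) : ‖(1 - Q ^ (i + 1)) * v‖ ≤ (1 + 1 * ‖Q‖ ^ i) * ‖v‖ := by
      rw [sub_mul, one_mul]
      refine (norm_sub_le _ _).trans ?_
      have j1 := norm_pow_mul_le Q v (i + 1)
      have j2 : ‖Q‖ ^ (i + 1) * ‖v‖ ≤ ‖Q‖ ^ i * ‖v‖ := by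
        gcongr ?_ * _
        exact pow_le_pow_of_le_one hq hQ.le (Nat.le_succ i)
      linarith
    have i2 (v : R) : ‖Ring.inverse (1 - A' * Q ^ (m + 1)) * v‖ ≤ (1 + K₁ * ‖Q‖ ^ m) * ‖v‖ := by
      have := h₁ 1 (one_mem_powersWithZero Q) m v
      rwa [one_mul, ← eA] at this
    have i3 (v : R) : ‖Ring.inverse (1 - Q ^ i * D) * v‖ ≤ (1 + K₂ * ‖Q‖ ^ i) * ‖v‖ := by
      simpa using h₂ 1 (one_mem_powersWithZero Q) i v
    have i4 (v : R) : ‖(D - Q ^ (m + 1) * E) * v‖ ≤ (‖D‖ + ‖Q‖ ^ (m + 1) * ‖E‖) * ‖v‖ := by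
      refine (norm_mul_le _ _).trans ?_
      gcongr
      exact (norm_sub_le _ _).trans (by gcongr; exact norm_pow_mul_le _ _ _)
    calc ‖negStep Q A' D E (Q ^ i) (Q ^ (i + 1)) m * y‖
        = ‖(1 - Q ^ (i + 1)) * (Ring.inverse (1 - A' * Q ^ (m + 1)) *
            (Ring.inverse (1 - Q ^ i * D) * ((D - Q ^ (m + 1) * E) * y)))‖ := by
          rw [negStep]; simp only [mul_assoc]
      _ ≤ (1 + 1 * ‖Q‖ ^ i) * ((1 + K₁ * ‖Q‖ ^ m) * ((1 + K₂ * ‖Q‖ ^ i) *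
            ((‖D‖ + ‖Q‖ ^ (m + 1) * ‖E‖) * ‖y‖))) := by
          refine (i1 _).trans ?_
          gcongr
          refine (i2 _).trans ?_
          gcongr
          refine (i3 _).trans ?_
          gcongr
          exact i4 _
      _ = σ i * r m * ‖y‖ := by simp only [hσ, hr]; ring
  have hprod (N m : ℕ) (hm : m ≤ N) :
      ‖negTermTrunc Q A' D E N m‖ * ∏ i ∈ Finset.range (N - m), σ i
        ≤ ‖(1 : R)‖ * (∏ i ∈ Finset.range N, σ i) * ∏ j ∈ Finset.range m, r j := by
    induction m with
    | zero => simp [negTermTrunc, negTerm]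
    | succ m ih =>
      obtain ⟨n, rfl⟩ := Nat.exists_eq_add_of_lt hm
      have ih := ih (by omega)
      rw [show m + n + 1 - m = n + 1 by omega, Finset.prod_range_succ] at ih
      rw [negTermTrunc_succ, show m + n + 1 - (m + 1) = n by omega,
        show m + n + 1 - 1 - m = n by omega, show m + n + 1 - m = n + 1 by omega,
        Finset.prod_range_succ _ m]
      have hP : 0 ≤ ∏ i ∈ Finset.range n, σ i := Finset.prod_nonneg fun i _ => hσ0 i
      refine (mul_le_mul_of_nonneg_right (hstep _ _ _) hP).trans ?_
      have := mul_le_mul_of_nonneg_right ih (hr0 m)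
      linarith
  have hσ1 (n : ℕ) : 1 ≤ ∏ i ∈ Finset.range n, σ i := by
    rw [← Finset.prod_const_one (s := Finset.range n)]
    exact Finset.prod_le_prod (fun _ _ => zero_le_one) fun i _ =>
      one_le_mul_of_one_le_of_one_le (le_add_of_nonneg_right (by positivity))
        (le_add_of_nonneg_right (by positivity))
  set M : ℝ := Real.exp (1 * (1 - ‖Q‖)⁻¹) * Real.exp (K₂ * (1 - ‖Q‖)⁻¹)
  have hσM (n : ℕ) : ∏ i ∈ Finset.range n, σ i ≤ M := by
    rw [Finset.prod_mul_distrib]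
    exact mul_le_mul (prod_one_add_mul_pow_le zero_le_one hq hQ n)
      (prod_one_add_mul_pow_le hK₂ hq hQ n) (Finset.prod_nonneg fun i _ => by positivity)
      (Real.exp_nonneg _)
  have hlim : Tendsto r atTop (nhds ‖D‖) := by
    have hq' : Tendsto (fun k : ℕ => ‖Q‖ ^ k) atTop (nhds 0) :=
      tendsto_pow_atTop_nhds_zero_of_lt_one hq hQ
    simpa using ((hq'.const_mul K₁).const_add 1).mul
      ((((tendsto_add_atTop_iff_nat 1).2 hq').mul_const ‖E‖).const_add ‖D‖)
  refine ⟨_, summable_prod_of_tendsto_lt_one hr0 hlim hD (‖(1 : R)‖ * M), fun N m => ?_⟩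
  have hR : 0 ≤ ∏ j ∈ Finset.range m, r j := Finset.prod_nonneg fun i _ => hr0 i
  by_cases hm : m ≤ N
  · calc ‖negTermTrunc Q A' D E N m‖
        ≤ ‖negTermTrunc Q A' D E N m‖ * ∏ i ∈ Finset.range (N - m), σ i :=
          le_mul_of_one_le_right (norm_nonneg _) (hσ1 _)
      _ ≤ _ := hprod N m hm
      _ ≤ _ := by gcongr; exact hσM N
  · rw [negTermTrunc_eq_zero _ _ _ _ (not_le.1 hm), norm_zero]
    positivity

theorem tendsto_negTermTrunc (hQ : ‖Q‖ < 1) (m : ℕ) :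
    Tendsto (fun N => negTermTrunc Q A' D E N m) atTop (nhds (negTerm Q A' D E 0 0 m)) := by
  induction m with
  | zero => exact tendsto_const_nhds
  | succ m ih =>
    have h1 : Tendsto (fun N : ℕ => Q ^ (N - 1 - m)) atTop (nhds 0) := by
      simp only [Nat.sub_sub]
      exact (tendsto_pow_zero hQ).comp (tendsto_sub_atTop_nat _)
    have h2 : Tendsto (fun N : ℕ => Q ^ (N - m)) atTop (nhds 0) :=
      (tendsto_pow_zero hQ).comp (tendsto_sub_atTop_nat _)
    refine Tendsto.mul ?_ ih
    exact ((h2.const_sub 1).mul_const _).mul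
      ((((h1.mul_const D).const_sub 1).ringInverse (by simp)).mul_const _)

theorem summable_negTerm (hQ : ‖Q‖ < 1) (hD : ‖D‖ < 1) (hQc : Q ∈ Subring.center R)
    (huD : ∀ k : ℕ, IsUnit (1 - Q ^ k * D)) (huA : ∀ k : ℕ, IsUnit (1 - A' * Q ^ (k + 1))) :
    Summable (negTerm Q A' D E 0 0) := by
  obtain ⟨b, hb, hle⟩ := exists_norm_negTermTrunc_le (E := E) hQ hD hQc huD huA
  exact Summable.of_norm_bounded hb fun m =>
    le_of_tendsto' (tendsto_negTermTrunc hQ m).norm fun N => hle N m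

theorem tendsto_tsum_negTermTrunc (hQ : ‖Q‖ < 1) (hD : ‖D‖ < 1) (hQc : Q ∈ Subring.center R)
    (huD : ∀ k : ℕ, IsUnit (1 - Q ^ k * D)) (huA : ∀ k : ℕ, IsUnit (1 - A' * Q ^ (k + 1))) :
    Tendsto (fun N => ∑' m, negTermTrunc Q A' D E N (m + 1)) atTop
      (nhds (∑' m, negTerm Q A' D E 0 0 (m + 1))) := by
  obtain ⟨b, hb, hle⟩ := exists_norm_negTermTrunc_le (E := E) hQ hD hQc huD huA
  exact tendsto_tsum_of_dominated_convergence ((summable_nat_add_iff 1).2 hb)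
    (fun m => tendsto_negTermTrunc hQ (m + 1)) (Eventually.of_forall fun N m => hle N (m + 1))

end NegativeBounds

section CentralProducts
variable {R : Type*} [Ring R]

theorem prod_map_range_mul {f g : ℕ → R} (hf : ∀ n, f n ∈ Subring.center R) (n : ℕ) :
    ((List.range n).map (fun i => f i * g i)).prod
      = ((List.range n).map f).prod * ((List.range n).map g).prod := by
  induction n with
  | zero => simp
  | succ n ih =>
    simp only [List.range_succ, List.map_append, List.prod_append, List.map_singleton,
      List.prod_singleton, ih, mul_assoc]
    rw [← mul_assoc _ (f n), Subring.mem_center_iff.1 (hf n), mul_assoc]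

theorem prod_map_range_reflect {f : ℕ → R} (hf : ∀ n, f n ∈ Subring.center R) (n : ℕ) :
    ((List.range n).map (fun i => f (n - 1 - i))).prod = ((List.range n).map f).prod := by
  induction n with
  | zero => simp
  | succ n ih =>
    rw [prod_map_range_reflect_succ, ih, List.range_succ, List.map_append, List.prod_append,
      List.map_singleton, List.prod_singleton, Subring.mem_center_iff.1 (hf n)]

end CentralProducts

section Bilateral
variable {R : Type*} [NormedRing R] [CompleteSpace R] {Q V A A' Z D E : R}

theorem qGaussSum_mul_negTermTrunc (hQ : ‖Q‖ < 1) (hZ : ‖Z‖ < 1)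
    (hQc : Q ∈ Subring.center R) (hVc : V ∈ Subring.center R)
    (hA : A ∈ Subring.center R) (hV : V * Q = 1) (hA' : A * A' = 1)
    (hA'c : A' ∈ Subring.center R) (hZE : Z * E = A')
    (huD : ∀ k : ℕ, IsUnit (1 - Q ^ k * D))
    (huC : ∀ n k : ℕ, IsUnit (1 - Q ^ k * (A * V ^ n * (Z * D))))
    (huA : ∀ k : ℕ, IsUnit (1 - A' * Q ^ (k + 1)))
    (huQ : ∀ k : ℕ, IsUnit (1 - Q ^ k * Q)) (N : ℕ) :
    qGaussSum Q Z D 1 (A * V ^ N) 1 * negTermTrunc Q A' D E N N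
      = ∑' m, negTermTrunc Q A' D E N (m + 1) + qGaussSum Q Z D 1 A (Q ^ N) := by
  have huQ' (k : ℕ) : IsUnit (1 - Q ^ (k + 1)) := by simpa [pow_succ] using huQ k
  have huC' (n : ℕ) : IsUnit (1 - A * V ^ n * (Z * D)) := by simpa using huC n 0
  have hs : Summable (gaussTerm Q Z D 1 (A * V ^ N) 1) := by
    obtain ⟨b, hb, hle⟩ :=
      exists_norm_gaussTerm_le hQ hZ hQc (mul_mem hA (pow_mem hVc N)) (huC N) huQ
    have h1 := one_mem_powersWithZero Q
    exact Summable.of_norm_bounded hb fun k => by simpa using hle 1 h1 1 h1 1 h1 k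
  rw [qGaussSum, ← hs.tsum_mul_right, ← (hs.mul_right _).sum_add_tsum_nat_add N]
  congr 1
  · rw [tsum_eq_sum (s := Finset.range N) fun m hm =>
      negTermTrunc_eq_zero _ _ _ _ (by simpa [Nat.lt_succ_iff] using hm), ← Finset.sum_range_reflect]
    refine Finset.sum_congr rfl fun k hk => ?_
    have hk := Finset.mem_range.1 hk
    rw [gaussTerm_mul_negTermTrunc hQc hVc hA hV hA' hA'c hZE huQ' huD huC' huA (by omega)]
    congr 1
    omega
  · exact tsum_congr fun k =>
      gaussTerm_add_mul_negTermTrunc hQc hVc hA hV hA' hA'c hZE huQ' huD huC' huA N k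

theorem qGaussSum_mul_negTermTrunc_eq_prod (hQ : ‖Q‖ < 1) (hZ : ‖Z‖ < 1)
    (hQc : Q ∈ Subring.center R) (hVc : V ∈ Subring.center R)
    (hA : A ∈ Subring.center R) (hV : V * Q = 1) (hA' : A * A' = 1)
    (hA'c : A' ∈ Subring.center R) (hZE : Z * E = A')
    (huD : ∀ k : ℕ, IsUnit (1 - Q ^ k * D))
    (huC : ∀ n k : ℕ, IsUnit (1 - Q ^ k * (A * V ^ n * (Z * D))))
    (huQ : ∀ k : ℕ, IsUnit (1 - Q ^ k * Q)) (huZ : ∀ k : ℕ, IsUnit (1 - Q ^ k * Z)) (N : ℕ) :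
    qGaussSum Q Z D 1 (A * V ^ N) 1 * negTermTrunc Q A' D E N N
      = ((List.range N).map (fun j =>
          Ring.inverse (1 - A' * Q ^ (j + 1)) * (1 - Q ^ (j + 1)) *
          (Ring.inverse (1 - Q ^ j * Z) * (1 - Q ^ j * (Z * D))))).prod *
        qGaussSum Q Z D (Q ^ N) A 1 * swapProd Q D (Q * E) N := by
  have hcomm {a : R} (ha : a ∈ Subring.center R) (x : R) : x * a = a * x :=
    Subring.mem_center_iff.1 ha x
  have huC' (n : ℕ) : IsUnit (1 - A * V ^ n * (Z * D)) := by simpa using huC n 0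
  have hX := prod_mul_negTermTrunc hQc hVc hA hV hA' hA'c hZE huD huC' (le_refl N)
  rw [Nat.sub_self, show swapProd Q D (Q ^ (N + 1) * E) 0 = 1 from rfl, one_mul] at hX
  have hi (j : ℕ) : Ring.inverse (1 - A' * Q ^ (j + 1)) ∈ Subring.center R :=
    inverse_mem_center (sub_mem (one_mem _) (mul_mem hA'c (pow_mem hQc _)))
  have hp (j : ℕ) : 1 - Q ^ (j + 1) ∈ Subring.center R := sub_mem (one_mem _) (pow_mem hQc _)
  set κ : R := ((List.range N).map (fun j =>
    Ring.inverse (1 - A' * Q ^ (j + 1)) * (1 - Q ^ (j + 1)))).prod with hκdef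
  have hκc : κ ∈ Subring.center R := list_prod_mem fun x hx => by
    obtain ⟨j, -, rfl⟩ := List.mem_map.1 hx
    exact mul_mem (hi j) (hp j)
  have hκ : ((List.range N).map (fun j =>
      (1 - Q ^ (N - j)) * Ring.inverse (1 - A' * Q ^ (j + 1)))).prod = κ := by
    have e : (List.range N).map (fun j =>
        (1 - Q ^ (N - j)) * Ring.inverse (1 - A' * Q ^ (j + 1)))
        = (List.range N).map (fun j =>
          Ring.inverse (1 - A' * Q ^ (j + 1)) * (1 - Q ^ (N - 1 - j + 1))) := by
      refine List.map_congr_left fun j hj => ?_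
      have := List.mem_range.1 hj
      rw [hcomm (hi j), show N - 1 - j + 1 = N - j by omega]
    rw [e, prod_map_range_mul hi, prod_map_range_reflect hp, ← prod_map_range_mul hi]
  have hiter := qGaussSum_iterate hQ hZ hQc (mul_mem hA (pow_mem hVc N)) (huC N) huQ
    (one_mem_powersWithZero Q) (by simpa using huZ) N
  have hVQ (i : ℕ) (hi : i < N) : A * V ^ N * Q ^ (N - 1 - i) = A * V ^ (i + 1) := by
    obtain ⟨n, rfl⟩ := Nat.exists_eq_add_of_lt hi
    rw [show i + n + 1 - 1 - i = n by omega, show i + n + 1 = i + 1 + n by ring, pow_add,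
      mul_assoc, mul_assoc, pow_mul_pow_of_mul_eq_one hQc hV, mul_one]
  have e1 : (List.range N).map (fun i =>
      Ring.inverse (1 - A * V ^ N * Q ^ (N - 1 - i) * (Z * D)) *
        (1 - A * V ^ N * Q ^ (N - 1 - i) * Z))
      = (List.range N).map (fun i => Ring.inverse (1 - A * V ^ (i + 1) * (Z * D)) *
        (1 - A * V ^ (i + 1) * Z)) :=
    List.map_congr_left fun i hi => by rw [hVQ i (List.mem_range.1 hi)]
  rw [e1, mul_assoc A, pow_mul_pow_of_mul_eq_one hQc hV, mul_one] at hiter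
  simp only [one_mul] at hiter
  rw [hiter, mul_assoc, hX, hκ, prod_map_range_mul fun j => mul_mem (hi j) (hp j), ← hκdef,
    ← mul_assoc, hcomm hκc]
  simp only [mul_assoc]

/-- The noncommutative ₁ψ₁ summation, as the sum of its parts of negative and nonnegative
index. -/
theorem tsum_negTerm_add_qGaussSum (hQ : ‖Q‖ < 1) (hZ : ‖Z‖ < 1) (hD : ‖D‖ < 1)
    (hQc : Q ∈ Subring.center R) (hVc : V ∈ Subring.center R)
    (hA : A ∈ Subring.center R) (hV : V * Q = 1) (hA' : A * A' = 1)
    (hA'c : A' ∈ Subring.center R) (hZE : Z * E = A')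
    (huD : ∀ k : ℕ, IsUnit (1 - Q ^ k * D))
    (huC : ∀ n k : ℕ, IsUnit (1 - Q ^ k * (A * V ^ n * (Z * D))))
    (huA : ∀ k : ℕ, IsUnit (1 - A' * Q ^ (k + 1)))
    (huQ : ∀ k : ℕ, IsUnit (1 - Q ^ k * Q)) (huZ : ∀ k : ℕ, IsUnit (1 - Q ^ k * Z))
    {P₁ P₂ P₃ : R}
    (hP₁ : Tendsto (fun n : ℕ => ((List.range n).map (fun j =>
          Ring.inverse (1 - A' * Q ^ (j + 1)) * (1 - Q ^ (j + 1)) *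
          (Ring.inverse (1 - Q ^ j * Z) * (1 - Q ^ j * (Z * D))))).prod) atTop (nhds P₁))
    (hP₂ : Tendsto (fun n : ℕ => ((List.range n).map
      (fun i => Ring.inverse (1 - A * Q ^ (n - 1 - i) * (Z * D)) *
        (1 - A * Q ^ (n - 1 - i) * Z))).prod) atTop (nhds P₂))
    (hP₃ : Tendsto (swapProd Q D (Q * E)) atTop (nhds P₃)) :
    ∑' m, negTerm Q A' D E 0 0 (m + 1) + qGaussSum Q Z D 1 A 0 = P₁ * P₂ * P₃ := by
  have hu (k : ℕ) : IsUnit (1 - Q ^ k * (A * (Z * D))) := by simpa using huC 0 k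
  have h0 := zero_mem_powersWithZero Q
  have h1 := one_mem_powersWithZero Q
  have hlim₁ := (tendsto_tsum_negTermTrunc (E := E) hQ hD hQc huD huA).add
    (tendsto_qGaussSum hQ hZ hQc hA hu huQ (tendsto_const_nhds (x := (1 : R)))
      (tendsto_const_nhds (x := (1 : R))) (tendsto_pow_zero hQ) (fun _ => h1) (fun _ => h1)
      (pow_mem_powersWithZero Q) h1 h0)
  have hlim₂ := (hP₁.mul (tendsto_qGaussSum hQ hZ hQc hA hu huQ (tendsto_pow_zero hQ)
      (tendsto_const_nhds (x := (1 : R))) (tendsto_const_nhds (x := (1 : R)))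
      (pow_mem_powersWithZero Q) (fun _ => h1) (fun _ => h1) h1 h1)).mul hP₃
  simp only [mul_one] at hlim₁ hlim₂
  rw [tendsto_prod_qGaussSum_zero hQ hZ hQc hA hu huQ hP₂] at hlim₂
  refine tendsto_nhds_unique hlim₁ (hlim₂.congr fun N => ?_)
  rw [← qGaussSum_mul_negTermTrunc_eq_prod hQ hZ hQc hVc hA hV hA' hA'c hZE huD huC huQ huZ,
    qGaussSum_mul_negTermTrunc hQ hZ hQc hVc hA hV hA' hA'c hZE huD huC huA huQ]

end Bilateral

section Terms
variable {R : Type*} [Ring R] {Q V A A' B Z D E : R}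

theorem zpowR_natCast (Q : R) (n : ℕ) : zpowR Q n = Q ^ n := by simp [zpowR]

theorem zpowR_neg_natCast (Q : R) (n : ℕ) : zpowR Q (-n) = Ring.inverse Q ^ n := by
  rcases Nat.eq_zero_or_pos n with rfl | hn
  · simp [zpowR]
  · simp [zpowR, hn.ne']

theorem pow_mul_inverse_pow (hQu : IsUnit Q) (k n : ℕ) :
    Q ^ k * Ring.inverse Q ^ n = zpowR Q (k - n) := by
  have h (m : ℕ) : Q ^ m * Ring.inverse Q ^ m = 1 := by
    have hc : Commute Q (Ring.inverse Q) := by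
      rw [Commute, SemiconjBy, Ring.mul_inverse_cancel _ hQu, Ring.inverse_mul_cancel _ hQu]
    rw [← hc.mul_pow, Ring.mul_inverse_cancel _ hQu, one_pow]
  rcases le_total n k with hk | hk
  · obtain ⟨j, rfl⟩ := Nat.exists_eq_add_of_le hk
    rw [add_comm n j, pow_add, mul_assoc, h, mul_one, ← zpowR_natCast]
    congr 1
    push_cast
    ring
  · obtain ⟨j, rfl⟩ := Nat.exists_eq_add_of_le hk
    rw [pow_add, ← mul_assoc, h, one_mul, ← zpowR_neg_natCast]
    congr 1
    push_cast
    ring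

theorem bprod_natCast (X : ℤ → R) (k : ℕ) :
    bprod X k = ((List.range k).map (fun i : ℕ => X ((i : ℤ) + 1))).prod := by
  rw [bprod, if_pos (Int.natCast_nonneg k), Int.toNat_natCast]
  simp only [bind_pure_comp, List.map_eq_map, List.map_map]
  rfl

theorem bprod_neg_natCast (X : ℤ → R) (m : ℕ) :
    bprod X (-m) = ((List.range m).map (fun i : ℕ => Ring.inverse (X (-(i : ℤ))))).prod := by
  rcases Nat.eq_zero_or_pos m with rfl | hm
  · simp [bprod]
  · rw [bprod, if_neg (by omega), neg_neg, Int.toNat_natCast]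
    simp only [bind_pure_comp, List.map_eq_map, List.map_map]
    rfl

theorem termI_zero (Q A B Z : R) : termI Q A B Z 0 = 1 := by simp [termI, bprod]

theorem termI_natCast (Q A B Z : R) (k : ℕ) :
    termI Q A B Z k = ((List.range k).map (fun i =>
      Ring.inverse (1 - B * Q ^ (k - 1 - i)) * (1 - A * Q ^ (k - 1 - i)) * Z)).prod := by
  rw [termI, bprod_natCast]
  congr 1
  refine List.map_congr_left fun i hi => ?_
  have hi := List.mem_range.1 hi
  rw [show (k : ℤ) - (i + 1) = (k - 1 - i : ℕ) by omega, zpowR_natCast]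

theorem termI_neg_natCast (Q A B Z : R) (m : ℕ) :
    termI Q A B Z (-m) = ((List.range m).map (fun i =>
      Ring.inverse (Ring.inverse (1 - B * Ring.inverse Q ^ (m - 1 - i + 1)) *
        (1 - A * Ring.inverse Q ^ (m - 1 - i + 1)) * Z))).prod := by
  rw [termI, bprod_neg_natCast]
  congr 1
  refine List.map_congr_left fun i hi => ?_
  have hi := List.mem_range.1 hi
  rw [show -(m : ℤ) - -(i : ℤ) = -((m - 1 - i + 1 : ℕ) : ℤ) by omega, zpowR_neg_natCast]

theorem termI_natCast_succ (Q A B Z : R) (k : ℕ) :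
    termI Q A B Z (k + 1 : ℕ) =
      Ring.inverse (1 - B * Q ^ k) * (1 - A * Q ^ k) * Z * termI Q A B Z k := by
  rw [termI_natCast, termI_natCast, prod_map_range_reflect_succ
    (fun j => Ring.inverse (1 - B * Q ^ j) * (1 - A * Q ^ j) * Z)]

theorem termI_neg_natCast_succ (Q A B Z : R) (m : ℕ) :
    termI Q A B Z (-(m + 1 : ℕ)) =
      Ring.inverse (Ring.inverse (1 - B * Ring.inverse Q ^ (m + 1)) *
        (1 - A * Ring.inverse Q ^ (m + 1)) * Z) * termI Q A B Z (-m) := by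
  rw [termI_neg_natCast, termI_neg_natCast, prod_map_range_reflect_succ
    (fun j => Ring.inverse (Ring.inverse (1 - B * Ring.inverse Q ^ (j + 1)) *
        (1 - A * Ring.inverse Q ^ (j + 1)) * Z))]

theorem mul_termI_natCast (hQ : Q ∈ Subring.center R) (hA : A ∈ Subring.center R)
    (hZB : Z * B = A * (Z * D) * Z) (huB : ∀ k : ℕ, IsUnit (1 - B * Q ^ k))
    (huC : ∀ k : ℕ, IsUnit (1 - A * Q ^ k * (Z * D))) (k : ℕ) :
    Z * termI Q A B Z k = gaussTerm Q Z D 1 A 0 k * Z := by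
  induction k with
  | zero => simp [termI_zero, gaussTerm]
  | succ k ih =>
    have hAQ : 1 - A * Q ^ k ∈ Subring.center R :=
      sub_mem (one_mem _) (mul_mem hA (pow_mem hQ k))
    have e1 : (1 - A * Q ^ k * (Z * D)) * Z = Z * (1 - B * Q ^ k) := by
      have hc := Subring.mem_center_iff.1 (pow_mem hQ k)
      rw [mul_sub, ← mul_assoc Z B, hZB, sub_mul, hc A, hc (A * (Z * D) * Z)]
      simp only [mul_assoc, one_mul, mul_one]
    have e2 : Ring.inverse (1 - A * Q ^ k * (Z * D)) * Z = Z * Ring.inverse (1 - B * Q ^ k) := by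
      rw [Ring.inverse_mul_eq_iff_eq_mul _ _ _ (huC k), ← mul_assoc, e1, mul_assoc,
        Ring.mul_inverse_cancel _ (huB k), mul_one]
    rw [termI_natCast_succ, gaussTerm, gaussStep]
    simp only [zero_mul, sub_zero, Ring.inverse_one, mul_one]
    rw [e2, mul_assoc _ (gaussTerm _ _ _ _ _ _ _) Z, ← ih, ← Subring.mem_center_iff.1 hAQ]
    simp only [mul_assoc]

theorem mul_termI_neg_natCast (hQ : Q ∈ Subring.center R) (hQu : IsUnit Q)
    (hA : A ∈ Subring.center R) (hA'c : A' ∈ Subring.center R) (hA' : A * A' = 1)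
    (hDZ : D * Z = A' * B) (hEZ : E * Z = A') (hZu : IsUnit Z)
    (huB : ∀ k : ℕ, IsUnit (1 - B * Ring.inverse Q ^ k))
    (huA : ∀ k : ℕ, IsUnit (1 - A * Ring.inverse Q ^ k))
    (huA' : ∀ k : ℕ, IsUnit (1 - A' * Q ^ (k + 1))) (m : ℕ) :
    Z * termI Q A B Z (-m) = negTerm Q A' D E 0 0 m * Z := by
  have hcomm {a : R} (ha : a ∈ Subring.center R) (x : R) : x * a = a * x :=
    Subring.mem_center_iff.1 ha x
  induction m with
  | zero => simp [termI_zero, negTerm]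
  | succ m ih =>
    rw [termI_neg_natCast_succ, negTerm, mul_assoc _ (negTerm _ _ _ _ _ _ _) Z, ← ih, ← mul_assoc,
      ← mul_assoc]
    congr 1
    have hqc : Q ^ (m + 1) ∈ Subring.center R := pow_mem hQ _
    have hvc : Ring.inverse Q ^ (m + 1) ∈ Subring.center R := pow_mem (inverse_mem_center hQ) _
    have hqv : Q ^ (m + 1) * Ring.inverse Q ^ (m + 1) = 1 := by
      rw [pow_mul_inverse_pow hQu, sub_self]; simp [zpowR]
    have huy : IsUnit (Ring.inverse (1 - B * Ring.inverse Q ^ (m + 1)) *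
        (1 - A * Ring.inverse Q ^ (m + 1)) * Z) :=
      (((huB _).ringInverse).mul (huA _)).mul hZu
    have huB := huB (m + 1)
    have huA' := huA' m
    rw [← (Ring.eq_mul_inverse_iff_mul_eq _ _ _ huy).2]
    simp only [negStep, Pi.zero_apply, zero_mul, sub_zero, Ring.inverse_one, one_mul]
    generalize Q ^ (m + 1) = q at *
    generalize Ring.inverse Q ^ (m + 1) = v at *
    have e1 : (D - q * E) * Z = -(A' * q) * (1 - B * v) := by
      rw [sub_mul, hDZ, mul_assoc, hEZ, mul_sub, hcomm hvc, ← mul_assoc, neg_mul, neg_mul,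
        mul_assoc A' q v,
        hqv, hcomm hA'c q]
      noncomm_ring
    have e2 : -(A' * q) * (1 - A * v) = 1 - A' * q := by
      rw [mul_sub, hcomm hvc A, ← mul_assoc, neg_mul, neg_mul, mul_assoc A' q v, hqv, neg_mul,
        mul_one, mul_one, hcomm hA, hA']
      noncomm_ring
    calc Ring.inverse (1 - A' * q) * (D - q * E) * Z *
          (Ring.inverse (1 - B * v) * (1 - A * v) * Z)
        = Ring.inverse (1 - A' * q) * ((D - q * E) * Z) * Ring.inverse (1 - B * v) *
          (1 - A * v) * Z := by simp only [mul_assoc]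
      _ = Ring.inverse (1 - A' * q) * (-(A' * q) * ((1 - B * v) * Ring.inverse (1 - B * v)) *
          (1 - A * v)) * Z := by rw [e1]; simp only [mul_assoc]
      _ = Z := by
        rw [Ring.mul_inverse_cancel _ huB, mul_one, e2, Ring.inverse_mul_cancel _ huA', one_mul]

end Terms

section Core
variable {R : Type*} [NormedRing R] [CompleteSpace R]

theorem hasSum_termI_of_central {Q A B Z : R} (hQc : Q ∈ Subring.center R)
    (hA : A ∈ Subring.center R) (hAu : IsUnit A) (hZu : IsUnit Z) (hQu : IsUnit Q)
    (huB : ∀ m : ℤ, IsUnit (1 - B * zpowR Q m))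
    (huA : ∀ m : ℤ, IsUnit (1 - A * zpowR Q m))
    (hu1 : ∀ j : ℕ, IsUnit (1 - Ring.inverse A * Q ^ (j + 1)))
    (hu2 : ∀ j : ℕ, IsUnit (1 - Z * Q ^ j))
    (hu4 : ∀ j : ℕ, IsUnit (1 - B * Ring.inverse Z * Ring.inverse A * Q ^ j))
    (hQ : ‖Q‖ < 1) (hZ : ‖Z‖ < 1)
    (hBZA : ‖B * Ring.inverse Z * Ring.inverse A‖ < 1) {P₁ P₂ P₃ : R}
    (hP₁ : Tendsto (fun n : ℕ => ((List.range n).map (fun j =>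
        Ring.inverse (1 - Ring.inverse A * Q ^ (j + 1)) * (1 - Q ^ (j + 1))
        * Ring.inverse (1 - Z * Q ^ j)
        * (1 - Z * B * Ring.inverse Z * Ring.inverse A * Q ^ j))).prod) atTop (nhds P₁))
    (hP₂ : Tendsto (fun k : ℕ => ((List.range k).map (fun i =>
        Ring.inverse (1 - Z * B * Ring.inverse Z * Q ^ (k - 1 - i))
        * (1 - A * Z * Q ^ (k - 1 - i)))).prod) atTop (nhds P₂))
    (hP₃ : Tendsto (fun n : ℕ => ((List.range n).map (fun j =>
        Ring.inverse (1 - B * Ring.inverse Z * Ring.inverse A * Q ^ j)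
        * (1 - Ring.inverse Z * Ring.inverse A * Q ^ (j + 1)))).prod) atTop (nhds P₃)) :
    HasSum (fun k : ℤ => termI Q A B Z k) (Ring.inverse Z * P₁ * P₂ * P₃ * Z) := by
  have hcomm {a : R} (ha : a ∈ Subring.center R) (x : R) : x * a = a * x :=
    Subring.mem_center_iff.1 ha x
  have hA' : A * Ring.inverse A = 1 := Ring.mul_inverse_cancel _ hAu
  have hA'c := inverse_mem_center hA
  have hVc := inverse_mem_center hQc
  have hV : Ring.inverse Q * Q = 1 := Ring.inverse_mul_cancel _ hQu
  have hZZ : Z * Ring.inverse Z = 1 := Ring.mul_inverse_cancel _ hZu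
  have hZZ' : Ring.inverse Z * Z = 1 := Ring.inverse_mul_cancel _ hZu
  have hZi : IsUnit (Ring.inverse Z) := hZu.ringInverse
  set A' := Ring.inverse A
  set V := Ring.inverse Q with hVdef
  set W := Ring.inverse Z
  set D := B * W * A' with hDdef
  set E := W * A' with hEdef
  have hZE : Z * E = A' := by rw [hEdef, ← mul_assoc, hZZ, one_mul]
  have hEZ : E * Z = A' := by rw [hEdef, mul_assoc, ← hcomm hA'c, ← mul_assoc, hZZ', one_mul]
  have hDZ : D * Z = A' * B := by
    rw [hDdef, mul_assoc, ← hcomm hA'c, ← mul_assoc, mul_assoc B, hZZ', mul_one, hcomm hA'c]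
  have hAZD : A * (Z * D) = Z * B * W := by
    rw [← mul_assoc, ← hcomm hA, hDdef, hcomm hA'c, mul_assoc Z, ← mul_assoc A, hA', one_mul,
      mul_assoc]
  have hZB : Z * B = A * (Z * D) * Z := by rw [hAZD, mul_assoc, hZZ', mul_one]
  have hzc (m : ℤ) : zpowR Q m ∈ Subring.center R := by
    rw [zpowR]
    split_ifs
    exacts [pow_mem hQc _, pow_mem hVc _]
  have huC (n k : ℕ) : IsUnit (1 - Q ^ k * (A * V ^ n * (Z * D))) := by
    have e : 1 - Q ^ k * (A * V ^ n * (Z * D)) = Z * (1 - B * zpowR Q (k - n)) * W := by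
      rw [hcomm (pow_mem hVc n), mul_assoc (V ^ n), hAZD, ← mul_assoc, pow_mul_inverse_pow hQu,
        mul_sub, sub_mul, mul_one, hZZ, hcomm (hzc _), ← mul_assoc Z, hcomm (hzc _)]
      simp only [mul_assoc]
    rw [e]
    exact (hZu.mul (huB _)).mul hZi
  have huD (k : ℕ) : IsUnit (1 - Q ^ k * D) := by
    rw [← hcomm (pow_mem hQc k)]
    exact hu4 k
  have huZ (k : ℕ) : IsUnit (1 - Q ^ k * Z) := by
    rw [← hcomm (pow_mem hQc k)]
    exact hu2 k
  have huQ (k : ℕ) : IsUnit (1 - Q ^ k * Q) := by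
    rw [← pow_succ]
    exact isUnit_one_sub_of_norm_lt_one ((norm_pow_le' Q k.succ_pos).trans_lt
      (pow_lt_one₀ (norm_nonneg _) hQ k.succ_ne_zero))
  have huBQ (k : ℕ) : IsUnit (1 - B * Q ^ k) := by simpa [zpowR_natCast] using huB k
  have huBV (k : ℕ) : IsUnit (1 - B * V ^ k) := by
    simpa only [zpowR_neg_natCast] using huB (-k)
  have huAV (k : ℕ) : IsUnit (1 - A * V ^ k) := by
    simpa only [zpowR_neg_natCast] using huA (-k)
  have hu (k : ℕ) : IsUnit (1 - Q ^ k * (A * (Z * D))) := by simpa using huC 0 k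
  have hmain : ∑' m, negTerm Q A' D E 0 0 (m + 1) + qGaussSum Q Z D 1 A 0 = P₁ * P₂ * P₃ := by
    refine tsum_negTerm_add_qGaussSum hQ hZ hBZA hQc hVc hA hV hA' hA'c hZE huD huC hu1 huQ huZ
      (hP₁.congr fun n => ?_) (hP₂.congr fun n => ?_) (hP₃.congr fun n => ?_)
    · congr 2
      funext j
      rw [hcomm (pow_mem hQc j) Z, ← hcomm (pow_mem hQc j) (Z * D), hDdef]
      simp only [mul_assoc]
    · congr 2
      funext i
      rw [hcomm (pow_mem hQc _) A, mul_assoc _ A, mul_assoc _ A, hAZD,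
        ← hcomm (pow_mem hQc _) (Z * B * W), ← hcomm (pow_mem hQc _) (A * Z)]
    · rw [swapProd]
      congr 2
      funext j
      rw [← hcomm (pow_mem hQc j) D, ← mul_assoc (Q ^ j), ← pow_succ,
        ← hcomm (pow_mem hQc (j + 1)) E]
  have hpos : HasSum (fun k : ℕ => termI Q A B Z k) (W * qGaussSum Q Z D 1 A 0 * Z) := by
    have hs : Summable (gaussTerm Q Z D 1 A 0) := by
      obtain ⟨b, hb, hle⟩ := exists_norm_gaussTerm_le hQ hZ hQc hA hu huQ
      have h1 := one_mem_powersWithZero Q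
      exact Summable.of_norm_bounded hb fun k => by
        simpa using hle 1 h1 1 h1 0 (zero_mem_powersWithZero Q) k
    refine ((hs.hasSum.mul_left W).mul_right Z).congr_fun fun k => ?_
    have := mul_termI_natCast (B := B) hQc hA hZB huBQ (fun k => by
      simpa using isUnit_gauss_den hA hu (one_mem_powersWithZero Q) k) k
    rw [mul_assoc, ← this, ← mul_assoc, hZZ', one_mul]
  have hneg : HasSum (fun m : ℕ => termI Q A B Z (-(m + 1)))
      (W * (∑' m, negTerm Q A' D E 0 0 (m + 1)) * Z) := by
    have hs : Summable fun m => negTerm Q A' D E 0 0 (m + 1) :=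
      (summable_nat_add_iff 1).2 (summable_negTerm hQ hBZA hQc huD hu1)
    refine ((hs.hasSum.mul_left W).mul_right Z).congr_fun fun m => ?_
    have := mul_termI_neg_natCast hQc hQu hA hA'c hA' hDZ hEZ hZu huBV huAV hu1 (m + 1)
    rw [mul_assoc, ← this, ← mul_assoc, hZZ', one_mul]
    push_cast
    rfl
  convert HasSum.of_nat_of_neg_add_one hpos hneg using 1
  rw [← add_mul, ← mul_add, add_comm, hmain]
  simp only [mul_assoc]

end Core

section Centralizer
variable {R : Type*}

section Ring
variable [Ring R] {s : Set R}

theorem isUnit_of_isUnit_coe_centralizer {x : Subring.centralizer s} (hx : IsUnit (x : R)) :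
    IsUnit x := by
  obtain ⟨u, hu⟩ := hx
  have hmem : ((u⁻¹ : Rˣ) : R) ∈ Subring.centralizer s :=
    Subring.mem_centralizer_iff.2 fun g hg => Commute.units_inv_right
      (show Commute g (u : R) from hu ▸ Subring.mem_centralizer_iff.1 x.2 g hg)
  refine ⟨⟨x, ⟨_, hmem⟩, Subtype.ext ?_, Subtype.ext ?_⟩, rfl⟩
  · simp [← hu]
  · simp [← hu]

theorem coe_inverse_centralizer (x : Subring.centralizer s) :
    ((Ring.inverse x : Subring.centralizer s) : R) = Ring.inverse (x : R) := by
  by_cases hx : IsUnit (x : R)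
  · have hu := isUnit_of_isUnit_coe_centralizer hx
    rw [← mul_one (Ring.inverse (x : R)), eq_comm, Ring.inverse_mul_eq_iff_eq_mul _ _ _ hx]
    exact (congrArg Subtype.val (Ring.mul_inverse_cancel x hu)).symm
  · have hu : ¬IsUnit x := fun h => hx (h.map (Subring.centralizer s).subtype)
    rw [Ring.inverse_non_unit _ hx, Ring.inverse_non_unit _ hu]
    rfl

theorem coe_prod_map_centralizer {ι : Type*} (l : List ι) (f : ι → Subring.centralizer s) :
    (((l.map f).prod : Subring.centralizer s) : R) = (l.map fun i => (f i : R)).prod := by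
  rw [← Subring.coe_subtype, map_list_prod, List.map_map]
  rfl

theorem coe_zpowR_centralizer (Q : Subring.centralizer s) (m : ℤ) :
    ((zpowR Q m : Subring.centralizer s) : R) = zpowR (Q : R) m := by
  rw [zpowR, zpowR]
  split_ifs <;> simp [coe_inverse_centralizer]

theorem coe_bprod_centralizer (X : ℤ → Subring.centralizer s) (k : ℤ) :
    ((bprod X k : Subring.centralizer s) : R) = bprod (fun j => (X j : R)) k := by
  obtain ⟨n, rfl | rfl⟩ := k.eq_nat_or_neg
  · rw [bprod_natCast, bprod_natCast, coe_prod_map_centralizer]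
  · simp only [bprod_neg_natCast, coe_prod_map_centralizer, coe_inverse_centralizer]

theorem coe_termI_centralizer (Q A B Z : Subring.centralizer s) (k : ℤ) :
    ((termI Q A B Z k : Subring.centralizer s) : R) = termI (Q : R) A B Z k := by
  simp only [termI, coe_bprod_centralizer, Subring.coe_mul, AddSubgroupClass.coe_sub, Subring.coe_one,
    coe_inverse_centralizer, coe_zpowR_centralizer]

theorem mem_center_centralizer {x : Subring.centralizer s} (hx : (x : R) ∈ s) :
    x ∈ Subring.center (Subring.centralizer s) :=
  Subring.mem_center_iff.2 fun g =>
    Subtype.ext (Subring.mem_centralizer_iff.1 g.2 x hx).symm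

end Ring

variable [NormedRing R] {s : Set R}

theorem exists_tendsto_centralizer {f : ℕ → Subring.centralizer s} {P : R}
    (h : Tendsto (fun n => (f n : R)) atTop (nhds P)) :
    ∃ P' : Subring.centralizer s, (P' : R) = P ∧ Tendsto f atTop (nhds P') := by
  have hP : P ∈ Subring.centralizer s :=
    (Set.isClosed_centralizer s).mem_of_tendsto h (Eventually.of_forall fun n => (f n).2)
  exact ⟨⟨P, hP⟩, rfl, tendsto_subtype_rng.2 h⟩

theorem hasSum_termI_of_mem_centralizer [CompleteSpace R] (Q A B Z : Subring.centralizer s)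
    (hQs : (Q : R) ∈ s) (hAs : (A : R) ∈ s)
    (hAu : IsUnit (A : R)) (hZu : IsUnit (Z : R)) (hQu : IsUnit (Q : R))
    (huB : ∀ m : ℤ, IsUnit (1 - (B : R) * zpowR (Q : R) m))
    (huA : ∀ m : ℤ, IsUnit (1 - (A : R) * zpowR (Q : R) m))
    (hu1 : ∀ j : ℕ, IsUnit (1 - Ring.inverse (A : R) * (Q : R) ^ (j + 1)))
    (hu2 : ∀ j : ℕ, IsUnit (1 - (Z : R) * (Q : R) ^ j))
    (hu4 : ∀ j : ℕ,
      IsUnit (1 - (B : R) * Ring.inverse (Z : R) * Ring.inverse (A : R) * (Q : R) ^ j))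
    (hQ : ‖(Q : R)‖ < 1) (hZ : ‖(Z : R)‖ < 1)
    (hBZA : ‖(B : R) * Ring.inverse (Z : R) * Ring.inverse (A : R)‖ < 1) {P₁ P₂ P₃ : R}
    (hP₁ : Tendsto (fun n : ℕ => ((List.range n).map (fun j =>
        Ring.inverse (1 - Ring.inverse (A : R) * (Q : R) ^ (j + 1)) * (1 - (Q : R) ^ (j + 1))
        * Ring.inverse (1 - (Z : R) * (Q : R) ^ j)
        * (1 - (Z : R) * B * Ring.inverse (Z : R) * Ring.inverse (A : R) * (Q : R) ^ j))).prod)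
        atTop (nhds P₁))
    (hP₂ : Tendsto (fun k : ℕ => ((List.range k).map (fun i =>
        Ring.inverse (1 - (Z : R) * B * Ring.inverse (Z : R) * (Q : R) ^ (k - 1 - i))
        * (1 - (A : R) * Z * (Q : R) ^ (k - 1 - i)))).prod) atTop (nhds P₂))
    (hP₃ : Tendsto (fun n : ℕ => ((List.range n).map (fun j =>
        Ring.inverse (1 - (B : R) * Ring.inverse (Z : R) * Ring.inverse (A : R) * (Q : R) ^ j)
        * (1 - Ring.inverse (Z : R) * Ring.inverse (A : R) * (Q : R) ^ (j + 1)))).prod)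
        atTop (nhds P₃)) :
    HasSum (fun k : ℤ => termI (Q : R) A B Z k) (Ring.inverse (Z : R) * P₁ * P₂ * P₃ * Z) := by
  have : CompleteSpace (Subring.centralizer s) :=
    (Set.isClosed_centralizer s).completeSpace_coe
  simp only [← coe_inverse_centralizer, ← coe_zpowR_centralizer, ← Subring.coe_mul,
    ← AddSubgroupClass.coe_sub, ← Subring.coe_pow, ← Subring.coe_one (Subring.centralizer s),
    ← coe_prod_map_centralizer] at *
  obtain ⟨P₁, rfl, hL₁⟩ := exists_tendsto_centralizer hP₁
  obtain ⟨P₂, rfl, hL₂⟩ := exists_tendsto_centralizer hP₂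
  obtain ⟨P₃, rfl, hL₃⟩ := exists_tendsto_centralizer hP₃
  simp only [← coe_termI_centralizer, ← Subring.coe_mul]
  exact (hasSum_termI_of_central (mem_center_centralizer hQs) (mem_center_centralizer hAs)
    (isUnit_of_isUnit_coe_centralizer hAu) (isUnit_of_isUnit_coe_centralizer hZu)
    (isUnit_of_isUnit_coe_centralizer hQu) (fun m => isUnit_of_isUnit_coe_centralizer (huB m))
    (fun m => isUnit_of_isUnit_coe_centralizer (huA m))
    (fun m => isUnit_of_isUnit_coe_centralizer (hu1 m))
    (fun m => isUnit_of_isUnit_coe_centralizer (hu2 m))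
    (fun m => isUnit_of_isUnit_coe_centralizer (hu4 m)) hQ hZ hBZA hL₁ hL₂ hL₃).map
    (Subring.centralizer s).subtype continuous_subtype_val

end Centralizer

/-- the noncommutative ₁ψ₁ summation of type I with `A` central:
`Σ_{k∈ℤ} ⌈A;B;Q,Z⌋_k = Z⁻¹ ⌊Q,ZBZ⁻¹A⁻¹;A⁻¹Q,Z;Q,I⌉_∞ ⌈AZ;ZBZ⁻¹;Q,I⌋_∞ ⌊Z⁻¹A⁻¹Q;BZ⁻¹A⁻¹;Q,I⌉_∞ Z`,
each infinite factorial being the limit of its partial products (the type I one being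
the limit as `k → ∞` of its falling-order partial products). -/
theorem nc_ramanujan_1psi1_typeI_Acentral {R : Type*} [NormedRing R] [NormedAlgebra ℂ R]
    [CompleteSpace R] (Q A B Z : R)
    (hQA : Q * A = A * Q) (hQB : Q * B = B * Q) (hQZ : Q * Z = Z * Q)
    (hAB : A * B = B * A) (hAZ : A * Z = Z * A)
    (hAu : IsUnit A) (hBu : IsUnit B) (hZu : IsUnit Z) (hQu : IsUnit Q)
    (huB : ∀ m : ℤ, IsUnit (1 - B * zpowR Q m))
    (huA : ∀ m : ℤ, IsUnit (1 - A * zpowR Q m))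
    (hu1 : ∀ j : ℕ, IsUnit (1 - Ring.inverse A * Q ^ (j + 1)))
    (hu2 : ∀ j : ℕ, IsUnit (1 - Z * Q ^ j))
    (hu3 : ∀ j : ℕ, IsUnit (1 - Z * B * Ring.inverse Z * Q ^ j))
    (hu4 : ∀ j : ℕ, IsUnit (1 - B * Ring.inverse Z * Ring.inverse A * Q ^ j))
    (hQ : ‖Q‖ < 1) (hZ : ‖Z‖ < 1)
    (hBZA : ‖B * Ring.inverse Z * Ring.inverse A‖ < 1)
    (P₁ P₂ P₃ : R)
    -- P₁ = ⌊Q, ZBZ⁻¹A⁻¹; A⁻¹Q, Z; Q, I⌉_∞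
    (hP₁ : Tendsto (fun n : ℕ => ((List.range n).map (fun j =>
        Ring.inverse (1 - Ring.inverse A * Q ^ (j + 1)) * (1 - Q ^ (j + 1))
        * Ring.inverse (1 - Z * Q ^ j)
        * (1 - Z * B * Ring.inverse Z * Ring.inverse A * Q ^ j))).prod) atTop (nhds P₁))
    -- P₂ = ⌈AZ; ZBZ⁻¹; Q, I⌋_∞, the limit of the falling-order partial products
    (hP₂ : Tendsto (fun k : ℕ => ((List.range k).map (fun i =>
        Ring.inverse (1 - Z * B * Ring.inverse Z * Q ^ (k - 1 - i))
        * (1 - A * Z * Q ^ (k - 1 - i)))).prod) atTop (nhds P₂))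
    -- P₃ = ⌊Z⁻¹A⁻¹Q; BZ⁻¹A⁻¹; Q, I⌉_∞
    (hP₃ : Tendsto (fun n : ℕ => ((List.range n).map (fun j =>
        Ring.inverse (1 - B * Ring.inverse Z * Ring.inverse A * Q ^ j)
        * (1 - Ring.inverse Z * Ring.inverse A * Q ^ (j + 1)))).prod) atTop (nhds P₃)) :
    HasSum (fun k : ℤ => termI Q A B Z k)
      (Ring.inverse Z * P₁ * P₂ * P₃ * Z) := by
  have hmem {x : R} (h1 : Q * x = x * Q) (h2 : A * x = x * A) :
      x ∈ Subring.centralizer ({Q, A} : Set R) :=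
    Subring.mem_centralizer_iff.2 fun g hg => by
      rcases hg with rfl | rfl
      exacts [h1, h2]
  exact hasSum_termI_of_mem_centralizer (s := {Q, A}) ⟨Q, hmem rfl hQA.symm⟩ ⟨A, hmem hQA rfl⟩
    ⟨B, hmem hQB hAB⟩ ⟨Z, hmem hQZ hAZ⟩ (Set.mem_insert _ _) (Set.mem_insert_of_mem _ rfl)
    hAu hZu hQu huB huA hu1 hu2 hu4 hQ hZ hBZA hP₁ hP₂ hP₃
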